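/- arXiv:1810.00624 — 4 statements merged into one kernel-verified Lean document; each statement's English description precedes it below -/
import Mathlib

section
/- Let G be a finite simple graph on an even number n ≥ 4 of vertices whose minimum degree δ satisfies δ > n/2. Then OPT(G) = n/2 + 1. -/
open SimpleGraph

/-- `C` is an edge 2-coloring of `G`: for every vertex, the edges incident to it
carry at most 2 distinct colors. -/
def IsEdge2Coloring {V : Type*} (G : SimpleGraph V) (C : Sym2 V → ℕ) : Prop :=
  ∀ v : V, (C '' G.incidenceSet v).ncard ≤ 2

/-- The number of distinct colors used by a coloring `C` on the edges of `G`. -/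
noncomputable def numColors {V : Type*} (G : SimpleGraph V) (C : Sym2 V → ℕ) : ℕ :=
  (C '' G.edgeSet).ncard

/-- `OPT G`: the maximum number of colors used by an edge 2-coloring of `G`. -/
noncomputable def OPT {V : Type*} (G : SimpleGraph V) : ℕ :=
  sSup {n : ℕ | ∃ C : Sym2 V → ℕ, IsEdge2Coloring G C ∧ numColors G C = n}

/-- `M` is a matching of `G`, given as a set of edges: the edges belong to `G` and
are pairwise vertex-disjoint. -/
def IsMatchingSet {V : Type*} (G : SimpleGraph V) (M : Set (Sym2 V)) : Prop :=
  M ⊆ G.edgeSet ∧ ∀ e ∈ M, ∀ f ∈ M, e ≠ f → ∀ v : V, v ∈ e → v ∉ f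

/-- `ALG G M`: number of colors produced by the matching based algorithm, i.e.
`|M|` plus the number of connected components of `G − M`. -/
noncomputable def ALG {V : Type*} (G : SimpleGraph V) (M : Set (Sym2 V)) : ℕ :=
  M.ncard + Nat.card (G.deleteEdges M).ConnectedComponent

/-- `H` is a characteristic subgraph of `G` with respect to the coloring `C`:
a subgraph of `G` containing exactly one edge of each color used by `C`. -/
def IsCharSubgraph {V : Type*} (G : SimpleGraph V) (C : Sym2 V → ℕ)
    (H : SimpleGraph V) : Prop :=
  H ≤ G ∧ ∀ c ∈ C '' G.edgeSet, ∃! e, e ∈ H.edgeSet ∧ C e = c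

/-- Combinatorial core of the upper bound: `P` is a family of nonempty palettes of size at most two
such that every palette meets many palettes, and `K` is a set of colors each lying in at least two
palettes. -/
theorem card_colors_le_of_palettes {V : Type*} [Fintype V] [DecidableEq V] {m : ℕ}
    (hV : Fintype.card V = 2 * m) (hm : 2 ≤ m) (P : V → Finset ℕ) (K : Finset ℕ)
    (hPK : ∀ v, P v ⊆ K) (hP : ∀ v, (P v).card ≤ 2) (hne : ∀ v, (P v).Nonempty)
    (hK : ∀ c ∈ K, 2 ≤ (Finset.univ.filter fun v => c ∈ P v).card)
    (hmeet : ∀ v, m + 2 ≤ (Finset.univ.filter fun x => ¬ Disjoint (P x) (P v)).card) :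
    K.card ≤ m + 1 := by
  have double_count : ∀ L : Finset ℕ,
      ∑ c ∈ L, (Finset.univ.filter fun v => c ∈ P v).card = ∑ v, (L ∩ P v).card := by
    intro L
    have := Finset.sum_card_bipartiteAbove_eq_sum_card_bipartiteBelow
      (s := L) (t := (Finset.univ : Finset V)) (fun c v => c ∈ P v)
    simpa [Finset.bipartiteAbove, Finset.bipartiteBelow, Finset.filter_mem_eq_inter] using this
  by_cases hdisj : ∃ u v, Disjoint (P u) (P v)
  · obtain ⟨u, v, huv⟩ := hdisj
    have excess : ∀ u, m - 1 + 2 * (P u).card ≤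
        ∑ c ∈ P u, (Finset.univ.filter fun v => c ∈ P v).card := by
      intro u
      have hu := hmeet u
      have hpos := (hne u).card_pos
      obtain h1 | h2 : (P u).card = 1 ∨ (P u).card = 2 := by have := hP u; omega
      · obtain ⟨a, ha⟩ := Finset.card_eq_one.1 h1
        simp only [ha, Finset.disjoint_singleton_right, not_not, Finset.sum_singleton,
          Finset.card_singleton] at hu ⊢
        omega
      · obtain ⟨a, b, hab, he⟩ := Finset.card_eq_two.1 h2
        have hunion : (Finset.univ.filter fun x => ¬ Disjoint (P x) (P u)) =
            (Finset.univ.filter fun v => a ∈ P v) ∪ (Finset.univ.filter fun v => b ∈ P v) := by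
          ext x
          simp only [he, Finset.disjoint_insert_right, Finset.disjoint_singleton_right,
            Finset.mem_filter, Finset.mem_univ, true_and, Finset.mem_union]
          tauto
        have hinter : 0 < ((Finset.univ.filter fun v => a ∈ P v) ∩
            (Finset.univ.filter fun v => b ∈ P v)).card :=
          Finset.card_pos.2 ⟨u, by simp [he]⟩
        have := Finset.card_union_add_card_inter (Finset.univ.filter fun v => a ∈ P v)
          (Finset.univ.filter fun v => b ∈ P v)
        rw [hunion] at hu
        rw [h2, he, Finset.sum_pair hab]
        omega
    have htotal : ∑ c ∈ K, (Finset.univ.filter fun v => c ∈ P v).card ≤ 2 * (2 * m) := by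
      rw [double_count, ← hV, mul_comm]
      refine (Finset.sum_le_card_nsmul Finset.univ _ 2 fun v _ => ?_).trans (by simp)
      exact (Finset.card_le_card Finset.inter_subset_right).trans (hP v)
    have hsub : P u ∪ P v ⊆ K := Finset.union_subset (hPK u) (hPK v)
    have hrest : (K \ (P u ∪ P v)).card * 2 ≤
        ∑ c ∈ K \ (P u ∪ P v), (Finset.univ.filter fun v => c ∈ P v).card :=
      Finset.card_nsmul_le_sum _ _ 2 fun c hc => hK c (Finset.mem_sdiff.1 hc).1
    rw [← Finset.sum_sdiff hsub, Finset.sum_union huv] at htotal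
    have hcard := Finset.card_sdiff_add_card_eq_card hsub
    rw [Finset.card_union_of_disjoint huv] at hcard
    have := excess u
    have := excess v
    omega
  · push Not at hdisj
    by_contra! hlarge
    obtain ⟨c, hc⟩ : ∃ c, ∀ v, c ∈ P v := by
      by_contra! hcon
      obtain ⟨u⟩ : Nonempty V := Fintype.card_pos_iff.1 (by omega)
      have pair : ∀ v, ∃ a b, P v = {a, b} := fun v => by
        obtain h1 | h2 : (P v).card = 1 ∨ (P v).card = 2 := by
          have := hP v; have := (hne v).card_pos; omega
        · obtain ⟨a, ha⟩ := Finset.card_eq_one.1 h1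
          exact ⟨a, a, by simp [ha]⟩
        · obtain ⟨a, b, -, h⟩ := Finset.card_eq_two.1 h2
          exact ⟨a, b, h⟩
      obtain ⟨a, b, hu⟩ := pair u
      obtain ⟨v, hv⟩ := hcon a
      obtain ⟨w, hw⟩ := hcon b
      obtain ⟨d, hd⟩ : ∃ d ∈ P v, d ≠ b := by
        by_contra! h
        obtain ⟨x, hx⟩ := hcon b
        exact hdisj v x (Finset.disjoint_left.2 fun y hy hy' => hx (h y hy ▸ hy'))
      have meets : ∀ x y, ∃ z ∈ P x, z ∈ P y := fun x y => by
        simpa [Finset.not_disjoint_iff] using hdisj x y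
      obtain ⟨e, heK, he⟩ : ∃ e ∈ K, e ∉ ({a, b, d} : Finset ℕ) := by
        by_contra! h
        have := Finset.card_le_card (show K ⊆ {a, b, d} from h)
        have := Finset.card_le_three (a := a) (b := b) (c := d)
        omega
      obtain ⟨x, hx⟩ := Finset.card_pos.1 (by have := hK e heK; omega :
        0 < (Finset.univ.filter fun v => e ∈ P v).card)
      have hex : e ∈ P x := by simpa using hx
      obtain ⟨x₁, x₂, hx'⟩ := pair x
      obtain ⟨v₁, v₂, hv'⟩ := pair v
      obtain ⟨w₁, w₂, hw'⟩ := pair w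
      have h1 := meets u v
      have h2 := meets u w
      have h3 := meets v w
      have h4 := meets u x
      have h5 := meets v x
      have h6 := meets w x
      simp only [hu, hv', hw', hx', Finset.mem_insert, Finset.mem_singleton] at *
      grind
    have hlow : (K.erase c).card * 2 ≤
        ∑ c ∈ K.erase c, (Finset.univ.filter fun v => c ∈ P v).card :=
      Finset.card_nsmul_le_sum _ _ 2 fun d hd => hK d (Finset.mem_of_mem_erase hd)
    have hupp : ∑ v, (K.erase c ∩ P v).card ≤ 2 * m := by
      rw [← hV]
      refine (Finset.sum_le_card_nsmul Finset.univ _ 1 fun v _ => ?_).trans (by simp)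
      have hsub : K.erase c ∩ P v ⊆ (P v).erase c := by
        intro d; simp +contextual
      have := Finset.card_le_card hsub
      rw [Finset.card_erase_of_mem (hc v)] at this
      have := hP v
      omega
    rw [double_count] at hlow
    have hcK : c ∈ K := by
      obtain ⟨u⟩ : Nonempty V := Fintype.card_pos_iff.1 (by omega)
      exact hPK u (hc u)
    rw [Finset.card_erase_of_mem hcK] at hlow
    omega

theorem numColors_le_of_large_minDegree {V : Type*} [Fintype V] (G : SimpleGraph V) {m : ℕ}
    (hV : Fintype.card V = 2 * m) (hm : 2 ≤ m) (hδ : ∀ v : V, m < (G.neighborSet v).ncard)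
    {C : Sym2 V → ℕ} (hC : IsEdge2Coloring G C) : numColors G C ≤ m + 1 := by
  classical
  have key := card_colors_le_of_palettes hV hm
    (fun v => (C '' G.incidenceSet v).toFinset) (C '' G.edgeSet).toFinset
    (fun v => by
      exact Set.toFinset_subset_toFinset.2 (Set.image_mono (G.incidenceSet_subset v)))
    (fun v => by rw [← Set.ncard_eq_toFinset_card']; exact hC v)
    (fun v => by
      obtain ⟨w, hw⟩ := Set.nonempty_of_ncard_ne_zero (Nat.ne_zero_of_lt (hδ v))
      exact ⟨C s(v, w), by simpa using ⟨_, G.mem_incidenceSet v w |>.2 hw, rfl⟩⟩)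
    (fun c hc => by
      obtain ⟨e, he, rfl⟩ : ∃ e ∈ G.edgeSet, C e = c := by simpa using hc
      induction e with | h x y => ?_
      rw [← Finset.card_pair (G.ne_of_adj he)]
      refine Finset.card_le_card fun z hz => ?_
      simp only [Finset.mem_filter, Finset.mem_univ, true_and, Set.mem_toFinset]
      refine ⟨s(x, y), ⟨he, ?_⟩, rfl⟩
      simpa using hz)
    (fun v => by
      have hcard : (insert v (G.neighborSet v)).ncard = (G.neighborSet v).ncard + 1 :=
        Set.ncard_insert_of_notMem (by simp)
      have := hδ v
      rw [Set.ncard_eq_toFinset_card'] at hcard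
      refine (by omega : m + 2 ≤ (insert v (G.neighborSet v)).toFinset.card).trans
        (Finset.card_le_card fun x hx => ?_)
      obtain ⟨w, hw⟩ := Set.nonempty_of_ncard_ne_zero (Nat.ne_zero_of_lt (hδ v))
      simp only [Finset.mem_filter, Finset.mem_univ, true_and, Finset.not_disjoint_iff,
        Set.mem_toFinset] at hx ⊢
      obtain rfl | hx := hx
      · exact ⟨C s(x, w), ⟨_, G.mem_incidenceSet x w |>.2 hw, rfl⟩,
          ⟨_, G.mem_incidenceSet x w |>.2 hw, rfl⟩⟩
      · exact ⟨C s(v, x), ⟨_, Sym2.eq_swap ▸ G.mem_incidenceSet x v |>.2 hx.symm, rfl⟩,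
          ⟨_, G.mem_incidenceSet v x |>.2 hx, rfl⟩⟩)
  rwa [numColors, Set.ncard_eq_toFinset_card']

/-- A graph on `2 * m` vertices with minimum degree greater than `m` has a perfect matching. -/
theorem exists_isPerfectMatching_of_large_minDegree {V : Type*} [Fintype V] (G : SimpleGraph V)
    {m : ℕ} (hV : Fintype.card V = 2 * m) (hδ : ∀ v : V, m < (G.neighborSet v).ncard) :
    ∃ M : G.Subgraph, M.IsPerfectMatching := by
  classical
  rw [SimpleGraph.tutte]
  intro S hS
  rw [SimpleGraph.IsTutteViolator] at hS
  set D := (⊤ : G.Subgraph).deleteVerts S with hD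
  have hverts : D.verts = Sᶜ := by simp [hD, Set.compl_eq_univ_sdiff]
  have hcard : Nat.card D.verts + S.ncard = 2 * m := by
    rw [Nat.card_coe_set_eq, hverts, add_comm, Set.ncard_add_ncard_compl, Nat.card_eq_fintype_card,
      hV]
  have hparity := D.coe.odd_ncard_oddComponents
  have hcomp : ∀ c : D.coe.ConnectedComponent, m + 2 ≤ c.supp.ncard + S.ncard := by
    intro c
    obtain ⟨v, hv⟩ := c.nonempty_supp
    have hsub : insert (v : V) (G.neighborSet v) ⊆ S ∪ Subtype.val '' c.supp := by
      rintro w (rfl | hw)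
      · exact Or.inr ⟨v, hv, rfl⟩
      · by_cases hwS : w ∈ S
        · exact Or.inl hwS
        · have hwD : w ∈ D.verts := by rw [hverts]; exact hwS
          have hvS : (v : V) ∉ S := hverts.subset v.2
          refine Or.inr ⟨⟨w, hwD⟩, c.mem_supp_of_adj_mem_supp hv ?_, rfl⟩
          simpa [hD, hvS, hwS] using hw
    have h1 := Set.ncard_le_ncard hsub
    have h2 := Set.ncard_union_le S (Subtype.val '' c.supp)
    rw [Set.ncard_insert_of_notMem (by simp)] at h1
    rw [Set.ncard_image_of_injective _ Subtype.val_injective] at h2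
    have := hδ v
    omega
  have hsum : ∀ k, (∀ c : D.coe.ConnectedComponent, k ≤ c.supp.ncard) →
      D.coe.oddComponents.ncard * k ≤ Nat.card D.verts := by
    intro k hk
    have hfib : Nat.card D.verts = ∑ c : D.coe.ConnectedComponent, c.supp.ncard := by
      rw [Nat.card_eq_fintype_card, ← Finset.card_univ,
        Finset.card_eq_sum_card_fiberwise (f := D.coe.connectedComponentMk) (t := Finset.univ)
          (by simp)]
      refine Finset.sum_congr rfl fun c _ => ?_
      rw [Set.ncard_eq_toFinset_card']
      congr 1
      ext v
      simp
    rw [hfib]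
    calc D.coe.oddComponents.ncard * k
        ≤ Nat.card D.coe.ConnectedComponent * k := Nat.mul_le_mul_right _ (Set.ncard_le_card _)
      _ ≤ _ := by
        rw [Nat.card_eq_fintype_card, ← Finset.card_univ]
        exact Finset.card_nsmul_le_sum _ _ k fun c _ => hk c
  have hN : S.ncard + 2 ≤ D.coe.oddComponents.ncard := by
    by_contra! hlt
    rw [show D.coe.oddComponents.ncard = S.ncard + 1 by omega] at hparity
    grind
  have hone := hsum 1 fun c => (Set.ncard_pos).2 c.nonempty_supp
  obtain ⟨t, ht⟩ : ∃ t, m = S.ncard + 1 + t := Nat.exists_eq_add_of_le (by omega)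
  have hmany := hsum (t + 3) fun c => by have := hcomp c; omega
  have := (Nat.mul_le_mul_right (t + 3) hN).trans hmany
  nlinarith

theorem ncard_edgeSet_of_isPerfectMatching {V : Type*} [Fintype V] {G : SimpleGraph V}
    {M : G.Subgraph} (hM : M.IsPerfectMatching) : 2 * M.edgeSet.ncard = Fintype.card V := by
  classical
  have hdeg : ∀ v, M.spanningCoe.degree v = 1 := fun v => by
    have := SimpleGraph.Subgraph.isPerfectMatching_iff_forall_degree.1 hM v
    simpa using this
  have := M.spanningCoe.sum_degrees_eq_twice_card_edges
  simp only [hdeg, Finset.sum_const, Finset.card_univ, smul_eq_mul, mul_one] at this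
  rw [this, ← SimpleGraph.Subgraph.edgeSet_spanningCoe, ← SimpleGraph.coe_edgeFinset,
    Set.ncard_coe_finset]

/-- Coloring the edges of a perfect matching with distinct colors and all other edges with one
further color. -/
theorem exists_coloring_of_isPerfectMatching {V : Type*} [Fintype V] {G : SimpleGraph V}
    {M : G.Subgraph} (hM : M.IsPerfectMatching) (hne : ∃ e ∈ G.edgeSet, e ∉ M.edgeSet) :
    ∃ C : Sym2 V → ℕ, IsEdge2Coloring G C ∧ numColors G C = M.edgeSet.ncard + 1 := by
  classical
  let f : Sym2 V → ℕ := fun e => (Fintype.equivFin (Sym2 V) e : ℕ) + 1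
  have hf : Function.Injective f := fun a b h => by simpa [f, Fin.val_inj] using h
  refine ⟨fun e => if e ∈ M.edgeSet then f e else 0, fun v => ?_, ?_⟩
  · obtain ⟨w, hw, huniq⟩ := SimpleGraph.Subgraph.isPerfectMatching_iff.1 hM v
    refine (Set.ncard_le_ncard (t := {0, f s(v, w)}) ?_).trans
      ((Set.ncard_insert_le _ _).trans (by simp))
    rintro _ ⟨e, ⟨-, hv⟩, rfl⟩
    obtain ⟨x, rfl⟩ := Sym2.mem_iff_exists.1 hv
    by_cases he : s(v, x) ∈ M.edgeSet
    · obtain rfl := huniq x he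
      simp [he]
    · simp [he]
  · have himage : (fun e => if e ∈ M.edgeSet then f e else 0) '' G.edgeSet =
        insert 0 (f '' M.edgeSet) := by
      ext c
      constructor
      · rintro ⟨e, he, rfl⟩
        by_cases heM : e ∈ M.edgeSet
        · exact Or.inr ⟨e, heM, by simp [heM]⟩
        · simp [heM]
      · rintro (rfl | ⟨e, he, rfl⟩)
        · obtain ⟨e, he, heM⟩ := hne
          exact ⟨e, he, by simp [heM]⟩
        · exact ⟨e, M.edgeSet_subset he, by simp [he]⟩
    rw [numColors, himage, Set.ncard_insert_of_notMem (by simp [f]),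
      Set.ncard_image_of_injective _ hf]

/-- For a graph on an even number `n ≥ 4` of vertices whose minimum degree exceeds `n/2`,
`OPT(G) = n/2 + 1`. -/
theorem opt_eq_of_large_minDegree {V : Type*} [Fintype V] (G : SimpleGraph V)
    (hn : Even (Fintype.card V)) (h4 : 4 ≤ Fintype.card V)
    (hδ : ∀ v : V, Fintype.card V / 2 < (G.neighborSet v).ncard) :
    OPT G = Fintype.card V / 2 + 1 := by
  obtain ⟨m, hm⟩ := hn
  have hV : Fintype.card V = 2 * m := by omega
  have hhalf : Fintype.card V / 2 = m := by omega
  rw [hhalf] at hδ ⊢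
  refine IsGreatest.csSup_eq ⟨?_, ?_⟩
  · obtain ⟨M, hM⟩ := exists_isPerfectMatching_of_large_minDegree G hV hδ
    have hcard := ncard_edgeSet_of_isPerfectMatching hM
    rw [show m = M.edgeSet.ncard by omega]
    refine exists_coloring_of_isPerfectMatching hM ?_
    obtain ⟨v⟩ : Nonempty V := Fintype.card_pos_iff.1 (by omega)
    obtain ⟨w, -, huniq⟩ := SimpleGraph.Subgraph.isPerfectMatching_iff.1 hM v
    obtain ⟨x, hx, hxw⟩ := Set.exists_ne_of_one_lt_ncard
      (show 1 < (G.neighborSet v).ncard by have := hδ v; omega) w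
    exact ⟨s(v, x), hx, fun h => hxw (huniq x h)⟩
  · rintro _ ⟨C, hC, rfl⟩
    exact numColors_le_of_large_minDegree G hV (by omega) hδ hC
end

section
/- Let G be a finite simple connected graph on n vertices with minimum degree δ ≥ 3, and let M be a maximum matching of G. Then OPT(G) ≤ (1 + ε)·ALG(G, M), where ε = (κ + 2)/(δ − 1) and κ = n/|M| is the ratio of the number of vertices of G to the size of a maximum matching of G. -/
open SimpleGraph

open Classical in
theorem card_covered_eq_two_mul {V : Type*} [Fintype V] {G : SimpleGraph V}
    {N : Finset (Sym2 V)} (hN : IsMatchingSet G (N : Set (Sym2 V))) :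
    (Finset.univ.filter fun v : V => ∃ e ∈ N, v ∈ e).card = 2 * N.card := by
  have h1 : (Finset.univ.filter fun v : V => ∃ e ∈ N, v ∈ e) = N.biUnion Sym2.toFinset := by
    ext v; simp
  rw [h1, Finset.card_biUnion, Finset.sum_congr rfl (g := fun _ => 2), Finset.sum_const,
    smul_eq_mul, mul_comm]
  · intro e he
    exact Sym2.card_toFinset_of_not_isDiag e (G.not_isDiag_of_mem_edgeSet (hN.1 he))
  · intro e he f hf hef
    rw [Function.onFun, Finset.disjoint_left]
    intro v hv hv'
    exact hN.2 e he f hf hef v (by simpa using hv) (by simpa using hv')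

theorem IsMatchingSet.mono {V : Type*} {G : SimpleGraph V} {M N : Set (Sym2 V)}
    (hN : IsMatchingSet G N) (h : M ⊆ N) : IsMatchingSet G M :=
  ⟨h.trans hN.1, fun e he f hf => hN.2 e (h he) f (h hf)⟩

theorem IsMatchingSet.insert_edge {V : Type*} {G : SimpleGraph V} {N : Set (Sym2 V)} {u v : V}
    (hN : IsMatchingSet G N) (huv : G.Adj u v) (hu : ∀ e ∈ N, u ∉ e) (hv : ∀ e ∈ N, v ∉ e) :
    IsMatchingSet G (insert s(u, v) N) := by
  refine ⟨Set.insert_subset huv hN.1, ?_⟩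
  rintro e (rfl | he) f (rfl | hf) hef w hw hwf
  · exact hef rfl
  · rcases Sym2.mem_iff.1 hw with rfl | rfl
    exacts [hu f hf hwf, hv f hf hwf]
  · rcases Sym2.mem_iff.1 hwf with rfl | rfl
    exacts [hu e he hw, hv e he hw]
  · exact hN.2 e he f hf hef w hw hwf

/-- No matching of `G` with at least `k` edges misses both `u` and `v`. -/
def NoCommonMiss {V : Type*} (G : SimpleGraph V) (k : ℕ) (u v : V) : Prop :=
  ∀ N : Finset (Sym2 V), IsMatchingSet G (N : Set (Sym2 V)) → N.card = k →
    (∀ e ∈ N, u ∉ e) → ¬ ∀ e ∈ N, v ∉ e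

open Classical in
theorem NoCommonMiss.trans {V : Type*} [Fintype V] {G : SimpleGraph V} {k : ℕ}
    (hk : ∀ N : Finset (Sym2 V), IsMatchingSet G (N : Set (Sym2 V)) → N.card ≤ k)
    {u t v : V} (ht : ∃ N : Finset (Sym2 V), IsMatchingSet G (N : Set (Sym2 V)) ∧ N.card = k ∧
      ∀ e ∈ N, t ∉ e) (huv : u ≠ v)
    (h1 : NoCommonMiss G k u t) (h2 : NoCommonMiss G k t v) : NoCommonMiss G k u v := by
  intro M hM hMk hMu hMv
  let S := (Finset.univ : Finset (Finset (Sym2 V))).filter fun N : Finset (Sym2 V) =>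
    IsMatchingSet G (N : Set (Sym2 V)) ∧ N.card = k ∧ ∀ e ∈ N, t ∉ e
  obtain ⟨N, hNS, hNmax⟩ := S.exists_max_image (fun N => (M ∩ N).card)
    (by obtain ⟨N, hN⟩ := ht; exact ⟨N, by simpa [S] using hN⟩)
  obtain ⟨hN, hNk, hNt⟩ : IsMatchingSet G (N : Set (Sym2 V)) ∧ N.card = k ∧ ∀ e ∈ N, t ∉ e := by
    simpa [S] using hNS
  have hNu : ∃ e ∈ N, u ∈ e := by
    by_contra! h
    exact h1 N hN hNk h hNt
  have hNv : ∃ e ∈ N, v ∈ e := by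
    by_contra! h
    exact h2 N hN hNk hNt h
  let cM := Finset.univ.filter fun v : V => ∃ e ∈ M, v ∈ e
  let cN := Finset.univ.filter fun v : V => ∃ e ∈ N, v ∈ e
  have hcM : cM.card = 2 * M.card := card_covered_eq_two_mul hM
  have hcN : cN.card = 2 * N.card := card_covered_eq_two_mul hN
  have hsd : (cM \ cN).card = (cN \ cM).card :=
    Finset.card_sdiff_comm (by rw [hcM, hcN, hMk, hNk])
  have htwo : 1 < (cN \ cM).card := by
    rw [Finset.one_lt_card]
    exact ⟨u, by simpa [cM, cN] using ⟨hNu, hMu⟩, v, by simpa [cM, cN] using ⟨hNv, hMv⟩, huv⟩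
  obtain ⟨x, hx, hxt⟩ := Finset.exists_mem_ne (hsd ▸ htwo) t
  obtain ⟨⟨e, heM, hxe⟩, hxN⟩ : (∃ e ∈ M, x ∈ e) ∧ ∀ e ∈ N, x ∉ e := by
    simpa [cM, cN] using hx
  obtain ⟨y, rfl⟩ := Sym2.mem_iff_exists.1 hxe
  have hxy : G.Adj x y := hM.1 heM
  have heN : s(x, y) ∉ N := fun h => hxN _ h hxe
  have hyN : ∃ f ∈ N, y ∈ f := by
    by_contra! h
    have := hk (insert s(x, y) N) (by
      rw [Finset.coe_insert]; exact hN.insert_edge hxy hxN h)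
    rw [Finset.card_insert_of_notMem heN] at this
    omega
  obtain ⟨f, hfN, hyf⟩ := hyN
  have hfM : f ∉ M := by
    intro hf
    refine hM.2 _ heM f hf ?_ y (by simp) hyf
    rintro rfl
    exact heN hfN
  have heN' : s(x, y) ∉ N.erase f := fun h => heN (Finset.mem_of_mem_erase h)
  have hmem : insert s(x, y) (N.erase f) ∈ S := by
    simp only [S, Finset.mem_filter, Finset.mem_univ, true_and]
    refine ⟨?_, ?_, ?_⟩
    · rw [Finset.coe_insert]
      refine (hN.mono (by simp)).insert_edge hxy
        (fun e he => hxN e (Finset.mem_of_mem_erase he)) fun e he hye => ?_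
      have he' := Finset.mem_erase.1 he
      exact hN.2 e he'.2 f hfN he'.1 y hye hyf
    · rw [Finset.card_insert_of_notMem heN', Finset.card_erase_of_mem hfN]
      have := Finset.card_pos.2 ⟨f, hfN⟩
      omega
    · intro e he hte
      rcases Finset.mem_insert.1 he with rfl | he
      · rcases Sym2.mem_iff.1 hte with rfl | rfl
        exacts [hxt rfl, hNt f hfN hyf]
      · exact hNt e (Finset.mem_of_mem_erase he) hte
  have hlt : (M ∩ N).card < (M ∩ insert s(x, y) (N.erase f)).card := by
    apply Finset.card_lt_card
    rw [Finset.ssubset_iff]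
    refine ⟨s(x, y), by simp [heN], ?_⟩
    intro g hg
    rcases Finset.mem_insert.1 hg with rfl | hg
    · simp [heM]
    · obtain ⟨hgM, hgN⟩ := Finset.mem_inter.1 hg
      refine Finset.mem_inter.2 ⟨hgM, Finset.mem_insert_of_mem (Finset.mem_erase.2 ⟨?_, hgN⟩)⟩
      rintro rfl
      exact hfM hgM
  exact absurd (hNmax _ hmem) (by simpa using hlt)

/-- **Gallai's lemma**: if every vertex is missed by some maximum matching, then no maximum
matching misses two vertices of the same connected component. -/
theorem noCommonMiss_of_reachable {V : Type*} [Fintype V] {G : SimpleGraph V} {k : ℕ}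
    (hk : ∀ N : Finset (Sym2 V), IsMatchingSet G (N : Set (Sym2 V)) → N.card ≤ k)
    (hmiss : ∀ t : V, ∃ N : Finset (Sym2 V), IsMatchingSet G (N : Set (Sym2 V)) ∧ N.card = k ∧
      ∀ e ∈ N, t ∉ e) {u v : V} (h : G.Reachable u v) (huv : u ≠ v) : NoCommonMiss G k u v := by
  classical
  have hadj : ∀ {x y : V}, G.Adj x y → NoCommonMiss G k x y := by
    intro x y hxy N hN hNk hx hy
    have := hk (insert s(x, y) N) (by
      rw [Finset.coe_insert]; exact hN.insert_edge hxy hx hy)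
    rw [Finset.card_insert_of_notMem fun h => hx _ h (by simp)] at this
    omega
  obtain ⟨p⟩ := h
  induction p with
  | nil => exact absurd rfl huv
  | @cons a b c hab q ih =>
    by_cases hbc : b = c
    · exact hbc ▸ hadj hab
    · exact NoCommonMiss.trans hk (hmiss b) huv (hadj hab) (ih hbc)

/-- `G` with all edges meeting `A` deleted. -/
def isolate {V : Type*} (G : SimpleGraph V) (A : Finset V) : SimpleGraph V where
  Adj u v := G.Adj u v ∧ u ∉ A ∧ v ∉ A
  symm := ⟨fun _ _ h => ⟨h.1.symm, h.2.2, h.2.1⟩⟩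
  loopless := ⟨fun _ h => G.loopless.irrefl _ h.1⟩

theorem isolate_edge_not_mem {V : Type*} {G : SimpleGraph V} {A : Finset V} {e : Sym2 V}
    (he : e ∈ (isolate G A).edgeSet) {a : V} (ha : a ∈ A) : a ∉ e := by
  induction e with
  | _ u v =>
    have h : G.Adj u v ∧ u ∉ A ∧ v ∉ A := he
    intro hae
    rcases Sym2.mem_iff.1 hae with rfl | rfl
    exacts [h.2.1 ha, h.2.2 ha]

theorem isolate_edgeSet_anti {V : Type*} {G : SimpleGraph V} {A B : Finset V} (h : A ⊆ B) :
    (isolate G B).edgeSet ⊆ (isolate G A).edgeSet :=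
  SimpleGraph.edgeSet_mono fun _ _ hab =>
    ⟨hab.1, fun ha => hab.2.1 (h ha), fun hb => hab.2.2 (h hb)⟩

open Classical in
theorem exists_set_forall_missed {V : Type*} [Fintype V] (G : SimpleGraph V) (m : ℕ)
    (hm : ∀ N : Finset (Sym2 V), IsMatchingSet G (N : Set (Sym2 V)) → N.card ≤ m) :
    ∃ (A : Finset V) (k : ℕ), A.card + k ≤ m ∧
      (∀ N : Finset (Sym2 V), IsMatchingSet (isolate G A) (N : Set (Sym2 V)) → N.card ≤ k) ∧
      ∀ t : V, ∃ N : Finset (Sym2 V), IsMatchingSet (isolate G A) (N : Set (Sym2 V)) ∧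
        N.card = k ∧ ∀ e ∈ N, t ∉ e := by
  let S := (Finset.univ : Finset (Finset V)).filter fun A =>
    ∀ N : Finset (Sym2 V), IsMatchingSet (isolate G A) (N : Set (Sym2 V)) → A.card + N.card ≤ m
  have hS : ∀ A, A ∈ S ↔ ∀ N : Finset (Sym2 V),
      IsMatchingSet (isolate G A) (N : Set (Sym2 V)) → A.card + N.card ≤ m := by
    intro A; simp [S]
  obtain ⟨A, hA, hAmax⟩ := S.exists_max_image Finset.card ⟨∅, by
    rw [hS]
    intro N hN
    simpa using hm N ⟨hN.1.trans (SimpleGraph.edgeSet_mono fun _ _ h => h.1), hN.2⟩⟩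
  rw [hS] at hA
  let T := (Finset.univ : Finset (Finset (Sym2 V))).filter fun N : Finset (Sym2 V) =>
    IsMatchingSet (isolate G A) (N : Set (Sym2 V))
  obtain ⟨N, hNT, hNmax⟩ := T.exists_max_image Finset.card ⟨∅, by simp [T, IsMatchingSet]⟩
  have hN : IsMatchingSet (isolate G A) (N : Set (Sym2 V)) := by simpa [T] using hNT
  have hle : ∀ N' : Finset (Sym2 V), IsMatchingSet (isolate G A) (N' : Set (Sym2 V)) →
      N'.card ≤ N.card := fun N' hN' => hNmax N' (by simpa [T] using hN')
  refine ⟨A, N.card, hA N hN, hle, fun t => ?_⟩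
  by_cases ht : t ∈ A
  · exact ⟨N, hN, rfl, fun e he => isolate_edge_not_mem (hN.1 he) ht⟩
  · have hins : insert t A ∉ S := fun h => by
      have := hAmax _ h
      rw [Finset.card_insert_of_notMem ht] at this
      omega
    rw [hS] at hins
    push Not at hins
    obtain ⟨N', hN', hlt⟩ := hins
    have hN'A : IsMatchingSet (isolate G A) (N' : Set (Sym2 V)) :=
      ⟨hN'.1.trans (isolate_edgeSet_anti (Finset.subset_insert t A)), hN'.2⟩
    refine ⟨N', hN'A, ?_, fun e he => isolate_edge_not_mem (hN'.1 he) (by simp)⟩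
    have h1 := hle N' hN'A
    have h2 := hA N hN
    rw [Finset.card_insert_of_notMem ht] at hlt
    omega

open Classical in
/-- The nontrivial direction of the **Tutte–Berge formula**, with the components of `G - A`
given as the fibres of a function `p`. -/
theorem exists_barrier {V : Type*} [Fintype V] (G : SimpleGraph V) (m : ℕ)
    (hm : ∀ N : Finset (Sym2 V), IsMatchingSet G (N : Set (Sym2 V)) → N.card ≤ m) :
    ∃ (A : Finset V) (p : V → V),
      (∀ u v, u ∉ A → v ∉ A → G.Adj u v → p u = p v) ∧
      A.card + ∑ b : V, (Finset.univ.filter fun v => v ∉ A ∧ p v = b).card / 2 ≤ m := by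
  obtain ⟨A, k, hAk, hk, hmiss⟩ := exists_set_forall_missed G m hm
  let p : V → V := fun v => ((isolate G A).connectedComponentMk v).out
  have hp : ∀ {u v}, p u = p v ↔ (isolate G A).Reachable u v := by
    intro u v
    rw [← SimpleGraph.ConnectedComponent.eq]
    refine ⟨fun h => ?_, fun h => by simp only [p, h]⟩
    rw [← Quot.out_eq ((isolate G A).connectedComponentMk u),
      ← Quot.out_eq ((isolate G A).connectedComponentMk v)]
    exact congrArg _ h
  have hpadj : ∀ {u v}, (isolate G A).Adj u v → p u = p v := fun h => hp.2 h.reachable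
  refine ⟨A, p, fun u v hu hv huv => hpadj ⟨huv, hu, hv⟩, ?_⟩
  suffices h : ∑ b : V, (Finset.univ.filter fun v => v ∉ A ∧ p v = b).card / 2 ≤ k by omega
  by_cases hV : IsEmpty V
  · simp
  obtain ⟨t⟩ := not_isEmpty_iff.1 hV
  obtain ⟨N, hN, hNk, -⟩ := hmiss t
  let F : V → Finset (Sym2 V) := fun b => N.filter fun e => ∃ v ∈ e, p v = b
  have hall : ∀ e ∈ N, ∀ u ∈ e, ∀ v ∈ e, p u = p v := by
    intro e he u hu v hv
    by_cases huv : u = v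
    · rw [huv]
    · rw [(Sym2.mem_and_mem_iff huv).1 ⟨hu, hv⟩] at he
      exact hpadj (hN.1 he)
  have hdisj : ∑ b : V, (F b).card ≤ N.card := by
    rw [← Finset.card_biUnion]
    · exact Finset.card_le_card (Finset.biUnion_subset.2 fun b _ => Finset.filter_subset _ _)
    · intro b _ c _ hbc
      rw [Function.onFun, Finset.disjoint_left]
      intro e he he'
      obtain ⟨heN, u, hu, rfl⟩ := Finset.mem_filter.1 he
      obtain ⟨-, v, hv, rfl⟩ := Finset.mem_filter.1 he'
      exact hbc (hall e heN u hu v hv)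
  refine le_trans (Finset.sum_le_sum fun b _ => ?_) (hdisj.trans hNk.le)
  let B := Finset.univ.filter fun v => v ∉ A ∧ p v = b
  let c := Finset.univ.filter fun v : V => ∃ e ∈ F b, v ∈ e
  have hc : c.card = 2 * (F b).card :=
    card_covered_eq_two_mul (hN.mono (Finset.coe_subset.2 (Finset.filter_subset _ _)))
  have hBc : (B \ c).card ≤ 1 := by
    rw [Finset.card_le_one]
    intro u hu v hv
    by_contra huv
    have key : ∀ x ∈ B \ c, p x = b ∧ ∀ e ∈ N, x ∉ e := by
      intro x hx
      obtain ⟨hxB, hxc⟩ := Finset.mem_sdiff.1 hx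
      have hxb : p x = b := (Finset.mem_filter.1 hxB).2.2
      refine ⟨hxb, fun e he hxe => hxc ?_⟩
      simp only [c, F, Finset.mem_filter, Finset.mem_univ, true_and]
      exact ⟨e, ⟨he, x, hxe, hxb⟩, hxe⟩
    exact noCommonMiss_of_reachable hk hmiss (hp.1 ((key u hu).1.trans (key v hv).1.symm)) huv
      N hN hNk (key u hu).2 (key v hv).2
  have := Finset.card_le_card_sdiff_add_card (s := B) (t := c)
  change B.card / 2 ≤ _
  omega

open Classical in
/-- The colors of the edges incident to `v`. -/
noncomputable def colorsAt {V : Type*} [Fintype V] (G : SimpleGraph V) (C : Sym2 V → ℕ) (v : V) :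
    Finset ℕ :=
  (Finset.univ.filter (G.Adj v)).image fun w => C s(v, w)

/-- The vertices incident to an edge of color `c`. -/
noncomputable def colorClass {V : Type*} [Fintype V] (G : SimpleGraph V) (C : Sym2 V → ℕ) (c : ℕ) :
    Finset V :=
  Finset.univ.filter fun v => c ∈ colorsAt G C v

theorem mem_colorsAt {V : Type*} [Fintype V] {G : SimpleGraph V} {C : Sym2 V → ℕ} {v : V} {c : ℕ} :
    c ∈ colorsAt G C v ↔ ∃ w, G.Adj v w ∧ C s(v, w) = c := by
  simp [colorsAt]

theorem mem_colorClass {V : Type*} [Fintype V] {G : SimpleGraph V} {C : Sym2 V → ℕ} {v : V}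
    {c : ℕ} : v ∈ colorClass G C c ↔ c ∈ colorsAt G C v := by
  simp [colorClass]

theorem mem_colorsAt_of_adj {V : Type*} [Fintype V] {G : SimpleGraph V} {C : Sym2 V → ℕ} {v w : V}
    (h : G.Adj v w) : C s(v, w) ∈ colorsAt G C w :=
  mem_colorsAt.2 ⟨v, h.symm, by rw [Sym2.eq_swap]⟩

open Classical in
theorem degree_add_card_colorsAt_le {V : Type*} [Fintype V] {G : SimpleGraph V} {C : Sym2 V → ℕ}
    {x : V} {S : Finset V} (hx : x ∈ S) (hS : ∀ w, G.Adj x w → w ∈ S) :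
    (Finset.univ.filter (G.Adj x)).card + (colorsAt G C x).card ≤
      ∑ c ∈ colorsAt G C x, (colorClass G C c ∩ S).card := by
  have h1 : Finset.univ.filter (G.Adj x) ⊆
      (colorsAt G C x).biUnion fun c => (colorClass G C c ∩ S).erase x := by
    intro w hw
    have hw : G.Adj x w := by simpa using hw
    simp only [Finset.mem_biUnion, Finset.mem_erase, Finset.mem_inter, mem_colorClass]
    exact ⟨C s(x, w), mem_colorsAt.2 ⟨w, hw, rfl⟩, hw.ne', mem_colorsAt_of_adj hw, hS w hw⟩
  have h2 := (Finset.card_le_card h1).trans Finset.card_biUnion_le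
  calc _ ≤ ∑ c ∈ colorsAt G C x, ((colorClass G C c ∩ S).erase x).card +
        ∑ c ∈ colorsAt G C x, 1 := by
        rw [← Finset.card_eq_sum_ones]; exact Nat.add_le_add_right h2 _
    _ = _ := by
        rw [← Finset.sum_add_distrib]
        refine Finset.sum_congr rfl fun c hc => ?_
        exact Finset.card_erase_add_one
          (Finset.mem_inter.2 ⟨mem_colorClass.2 hc, hx⟩)

theorem div_add_div_le_half_add_one {D a b : ℚ} (ha : 2 ≤ a) (hb : 2 ≤ b) (hD : 0 ≤ D)
    (hab : D + 3 ≤ a + b) : D / a + D / b ≤ D / 2 + 1 := by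
  rw [div_add_div _ _ (by positivity) (by positivity), div_le_iff₀ (by positivity)]
  nlinarith [mul_nonneg (sub_nonneg.2 ha) (sub_nonneg.2 hb),
    mul_nonneg hD (mul_nonneg (sub_nonneg.2 ha) (sub_nonneg.2 hb))]

/-- The share that each vertex of a barrier pays for a color whose class has `α` vertices inside
the barrier and `β` outside. -/
def barrierShare (D α β : ℕ) : ℚ :=
  (if 2 * α < D + 1 then ((D - β : ℕ) : ℚ) else D) / α

theorem barrierShare_le_div (D α β : ℕ) : barrierShare D α β ≤ D / α := by
  unfold barrierShare
  gcongr
  split_ifs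
  · exact_mod_cast Nat.sub_le _ _
  · exact le_rfl

theorem barrierShare_le (D : ℕ) {α : ℕ} (β : ℕ) (hα : 1 ≤ α) : barrierShare D α β ≤ D := by
  refine (barrierShare_le_div D α β).trans (div_le_self (by positivity) (by exact_mod_cast hα))

theorem barrierShare_le_half (D : ℕ) {α : ℕ} (β : ℕ) (hα : 2 ≤ α) :
    barrierShare D α β ≤ D / 2 := by
  refine (barrierShare_le_div D α β).trans ?_
  gcongr
  exact_mod_cast hα

theorem barrierShare_one_add_le {D α β β' : ℕ} (hD : 2 ≤ D) (hα : 1 ≤ α)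
    (h : D + 3 ≤ (1 + β) + (α + β')) :
    barrierShare D 1 β + barrierShare D α β' ≤ D + 2 := by
  have hα0 : (0 : ℚ) < α := by exact_mod_cast hα
  have h1 : barrierShare D 1 β = ((D - β : ℕ) : ℚ) := by
    simp [barrierShare, show 2 < D + 1 by omega]
  have h1' : barrierShare D 1 β ≤ D := barrierShare_le D β le_rfl
  by_cases hl : 2 * α < D + 1
  · have h2 : barrierShare D α β' = ((D - β' : ℕ) : ℚ) / α := by simp [barrierShare, hl]
    rcases le_total D β with hβ | hβ
    · rw [h1, Nat.sub_eq_zero_of_le hβ]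
      have := barrierShare_le D β' hα
      push_cast
      linarith
    · have h3 : ((D - β' : ℕ) : ℚ) / α ≤ β + 1 := by
        rw [div_le_iff₀ hα0]
        have h4 : D - β' ≤ (β + 1) * α := by
          have : β ≤ β * α := Nat.le_mul_of_pos_right _ hα
          have : (β + 1) * α = β * α + α := by ring
          omega
        exact_mod_cast h4
      rw [h1, h2, Nat.cast_sub hβ]
      linarith
  · have h2 : barrierShare D α β' = D / α := by simp [barrierShare, hl]
    have h3 : (D : ℚ) / α ≤ 2 := by
      rw [div_le_iff₀ hα0]
      exact_mod_cast (by omega : D ≤ 2 * α)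
    linarith

theorem barrierShare_add_le {D α α' β β' : ℕ} (hD : 2 ≤ D) (hα : 1 ≤ α) (hα' : 1 ≤ α')
    (h : D + 3 ≤ (α + β) + (α' + β')) :
    barrierShare D α β + barrierShare D α' β' ≤ D + 2 := by
  rcases hα.eq_or_lt with rfl | h2
  · exact barrierShare_one_add_le hD hα' h
  rcases hα'.eq_or_lt with rfl | h2'
  · rw [add_comm]
    exact barrierShare_one_add_le hD hα (by omega)
  · have := barrierShare_le_half D β h2
    have := barrierShare_le_half D β' h2'
    linarith

/-- The number of colors at `x` whose class meets `A` in at least one but fewer than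
`(D + 1) / 2` vertices. -/
noncomputable def lightCount {V : Type*} [Fintype V] (G : SimpleGraph V) (C : Sym2 V → ℕ)
    (D : ℕ) (A : Finset V) (x : V) : ℕ := by
  classical
  exact ((colorsAt G C x).filter fun c =>
    (∃ a ∈ A, c ∈ colorsAt G C a) ∧ 2 * (colorClass G C c ∩ A).card < D + 1).card

open Classical in
theorem sum_barrierShare_le {V : Type*} [Fintype V] {G : SimpleGraph V} {C : Sym2 V → ℕ} {D : ℕ}
    (hD : 2 ≤ D) {v : V} {A : Finset V} (hv : v ∈ A)
    (hdeg : D + 1 ≤ (Finset.univ.filter (G.Adj v)).card) (hC : (colorsAt G C v).card ≤ 2) :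
    ∑ c ∈ colorsAt G C v,
      barrierShare D (colorClass G C c ∩ A).card (colorClass G C c \ A).card ≤ D + 2 := by
  have hα : ∀ c ∈ colorsAt G C v, 1 ≤ (colorClass G C c ∩ A).card := fun c hc =>
    Finset.card_pos.2 ⟨v, Finset.mem_inter.2 ⟨mem_colorClass.2 hc, hv⟩⟩
  have hsum := degree_add_card_colorsAt_le (G := G) (C := C) (Finset.mem_univ v)
    fun w _ => Finset.mem_univ w
  simp only [Finset.inter_univ] at hsum
  have hsplit : ∀ c, (colorClass G C c).card =
      (colorClass G C c ∩ A).card + (colorClass G C c \ A).card := fun c =>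
    (Finset.card_inter_add_card_sdiff _ _).symm
  obtain h | h | h : (colorsAt G C v).card = 0 ∨ (colorsAt G C v).card = 1 ∨
    (colorsAt G C v).card = 2 := by omega
  · rw [Finset.card_eq_zero.1 h, Finset.sum_empty]
    positivity
  · obtain ⟨c, hc⟩ := Finset.card_eq_one.1 h
    rw [hc, Finset.sum_singleton]
    have := barrierShare_le D (colorClass G C c \ A).card (hα c (by simp [hc]))
    linarith
  · obtain ⟨c, c', hcc, hc⟩ := Finset.card_eq_two.1 h
    rw [h, hc, Finset.sum_pair hcc, hsplit c, hsplit c'] at hsum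
    rw [hc, Finset.sum_pair hcc]
    exact barrierShare_add_le hD (hα c (by simp [hc])) (hα c' (by simp [hc])) (by omega)

open Classical in
theorem card_touching_mul_le {V : Type*} [Fintype V] {G : SimpleGraph V} {C : Sym2 V → ℕ} {D : ℕ}
    (hD : 2 ≤ D) (A : Finset V) (hdeg : ∀ v, D + 1 ≤ (Finset.univ.filter (G.Adj v)).card)
    (hC : ∀ v, (colorsAt G C v).card ≤ 2) :
    D * (A.biUnion (colorsAt G C)).card ≤ ∑ x ∈ Aᶜ, lightCount G C D A x + A.card * (D + 2) := by
  let T := A.biUnion (colorsAt G C)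
  let α : ℕ → ℕ := fun c => (colorClass G C c ∩ A).card
  let β : ℕ → ℕ := fun c => (colorClass G C c \ A).card
  have hlight : ∑ c ∈ T with 2 * α c < D + 1, β c = ∑ x ∈ Aᶜ, lightCount G C D A x := by
    simp only [β, lightCount, Finset.card_eq_sum_ones]
    refine Finset.sum_comm' fun c x => ?_
    simp only [T, α, Finset.mem_filter, Finset.mem_biUnion, Finset.mem_sdiff, mem_colorClass,
      Finset.mem_compl, ← Finset.card_eq_sum_ones]
    tauto
  have hshare : ∑ c ∈ T, (α c : ℚ) * barrierShare D (α c) (β c) =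
      ∑ v ∈ A, ∑ c ∈ colorsAt G C v, barrierShare D (α c) (β c) := by
    have h1 : ∀ c ∈ T, (α c : ℚ) * barrierShare D (α c) (β c) =
        ∑ v ∈ colorClass G C c ∩ A, barrierShare D (α c) (β c) := fun c _ => by
      rw [Finset.sum_const, nsmul_eq_mul]
    rw [Finset.sum_congr rfl h1]
    refine Finset.sum_comm' fun c x => ?_
    simp only [T, Finset.mem_biUnion, Finset.mem_inter, mem_colorClass]
    exact ⟨fun h => ⟨h.2.1, h.2.2⟩, fun h => ⟨⟨x, h.2, h.1⟩, h.1, h.2⟩⟩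
  have hbound : ∑ v ∈ A, ∑ c ∈ colorsAt G C v, barrierShare D (α c) (β c) ≤
      A.card * ((D : ℚ) + 2) := by
    rw [← nsmul_eq_mul]
    exact Finset.sum_le_card_nsmul _ _ _ fun v hv => sum_barrierShare_le hD hv (hdeg v) (hC v)
  have hpt : ∀ c ∈ T, (D : ℚ) ≤ (if 2 * α c < D + 1 then (β c : ℚ) else 0) +
      α c * barrierShare D (α c) (β c) := by
    intro c hc
    obtain ⟨a, ha, hca⟩ := Finset.mem_biUnion.1 hc
    have hα : (α c : ℚ) ≠ 0 := by
      have : 0 < α c := Finset.card_pos.2 ⟨a, Finset.mem_inter.2 ⟨mem_colorClass.2 hca, ha⟩⟩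
      positivity
    unfold barrierShare
    rw [mul_div_cancel₀ _ hα]
    split_ifs
    · exact_mod_cast (by omega : D ≤ β c + (D - β c))
    · simp
  have hfin : (D : ℚ) * T.card ≤
      (∑ x ∈ Aᶜ, lightCount G C D A x : ℕ) + A.card * ((D : ℚ) + 2) := by
    rw [← hlight, Finset.sum_filter]
    push_cast
    calc (D : ℚ) * T.card = ∑ c ∈ T, (D : ℚ) := by rw [Finset.sum_const, nsmul_eq_mul, mul_comm]
      _ ≤ _ := Finset.sum_le_sum hpt
      _ ≤ _ := by
        rw [Finset.sum_add_distrib, hshare]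
        gcongr
  exact_mod_cast hfin

open Classical in
theorem card_inside_mul_le {V : Type*} [Fintype V] {G : SimpleGraph V} {C : Sym2 V → ℕ} {D : ℕ}
    (hD : 2 ≤ D) {A B : Finset V} (hAB : Disjoint A B)
    (hB : ∀ x ∈ B, ∀ w, G.Adj x w → w ∈ A ∨ w ∈ B)
    (hdeg : ∀ v, D + 1 ≤ (Finset.univ.filter (G.Adj v)).card)
    (hC : ∀ v, (colorsAt G C v).card ≤ 2) :
    D * ((B.biUnion (colorsAt G C)).filter fun c => ¬∃ a ∈ A, c ∈ colorsAt G C a).card +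
      ∑ x ∈ B, lightCount G C D A x ≤ D * (B.card / 2) + (B.card + 2 * (B.card / 2)) := by
  let P : ℕ → Prop := fun c => ∃ a ∈ A, c ∈ colorsAt G C a
  let I := (B.biUnion (colorsAt G C)).filter fun c => ¬P c
  let i : V → ℕ := fun x => ((colorsAt G C x).filter fun c => ¬P c).card
  let t : V → ℕ := lightCount G C D A
  change D * I.card + ∑ x ∈ B, t x ≤ _
  have hit : ∀ x, i x + t x ≤ 2 := by
    intro x
    refine le_trans ?_ (hC x)
    rw [← Finset.card_filter_add_card_filter_not (s := colorsAt G C x) (p := P), add_comm]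
    refine Nat.add_le_add_right (Finset.card_le_card fun c hc => ?_) _
    rw [Finset.mem_filter] at hc ⊢
    exact ⟨hc.1, hc.2.1⟩
  have hnbr : ∀ x ∈ B, ∀ w, G.Adj x w → ¬P (C s(x, w)) → w ∈ B := by
    intro x hx w hxw hP
    refine (hB x hx w hxw).resolve_left fun hwA => hP ⟨w, hwA, mem_colorsAt_of_adj hxw⟩
  have htwo : ∀ x ∈ B, ∀ c ∈ colorsAt G C x, ¬P c → 2 ≤ (colorClass G C c ∩ B).card := by
    intro x hx c hc hP
    obtain ⟨w, hxw, rfl⟩ := mem_colorsAt.1 hc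
    refine Finset.one_lt_card.2 ⟨x, ?_, w, ?_, hxw.ne⟩
    · exact Finset.mem_inter.2 ⟨mem_colorClass.2 hc, hx⟩
    · exact Finset.mem_inter.2
        ⟨mem_colorClass.2 (mem_colorsAt_of_adj hxw), hnbr x hx w hxw hP⟩
  have hall : ∀ x ∈ B, i x = 2 → (colorsAt G C x).card = 2 ∧ (∀ c ∈ colorsAt G C x, ¬P c) ∧
      ∀ w, G.Adj x w → w ∈ B := by
    intro x hx hi
    have h1 : (colorsAt G C x).filter (fun c => ¬P c) = colorsAt G C x :=
      Finset.eq_of_subset_of_card_le (Finset.filter_subset _ _) ((hC x).trans hi.ge)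
    have h2 : ∀ c ∈ colorsAt G C x, ¬P c := Finset.filter_eq_self.1 h1
    exact ⟨h1 ▸ hi, h2, fun w hw => hnbr x hx w hw (h2 _ (mem_colorsAt.2 ⟨w, hw, rfl⟩))⟩
  rcases le_or_gt B.card D with hs | hs
  · have hi1 : ∀ x ∈ B, i x ≤ 1 := by
      intro x hx
      by_contra hcon
      have hi : i x = 2 := by have := hit x; omega
      have hsub : Finset.univ.filter (G.Adj x) ⊆ B := fun w hw =>
        (hall x hx hi).2.2 w (by simpa using hw)
      have := (hdeg x).trans (Finset.card_le_card hsub)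
      omega
    have hsumI : 2 * I.card ≤ ∑ x ∈ B, i x := by
      have h1 : ∑ c ∈ I, (colorClass G C c ∩ B).card = ∑ x ∈ B, i x := by
        simp only [i, Finset.card_eq_sum_ones]
        refine Finset.sum_comm' fun c x => ?_
        simp only [I, Finset.mem_filter, Finset.mem_biUnion, Finset.mem_inter, mem_colorClass]
        exact ⟨fun h => ⟨⟨h.2.1, h.1.2⟩, h.2.2⟩, fun h => ⟨⟨⟨x, h.2, h.1.1⟩, h.1.2⟩, h.1.1, h.2⟩⟩
      rw [← h1, mul_comm, ← smul_eq_mul]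
      refine Finset.card_nsmul_le_sum _ _ _ fun c hc => ?_
      obtain ⟨hc, hP⟩ := Finset.mem_filter.1 hc
      obtain ⟨x, hx, hcx⟩ := Finset.mem_biUnion.1 hc
      exact htwo x hx c hcx hP
    have hsumi : ∑ x ∈ B, i x ≤ B.card := by
      simpa using Finset.sum_le_card_nsmul B i 1 hi1
    have hsumit : ∑ x ∈ B, i x + ∑ x ∈ B, t x ≤ 2 * B.card := by
      rw [← Finset.sum_add_distrib, mul_comm, ← smul_eq_mul]
      exact Finset.sum_le_card_nsmul _ _ _ fun x _ => hit x
    have hI : D * I.card ≤ D * (B.card / 2) := Nat.mul_le_mul_left _ (by omega)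
    by_cases hgood : ∑ x ∈ B, t x ≤ B.card + 2 * (B.card / 2)
    · omega
    have hI0 : I.card = 0 := by omega
    rw [hI0, mul_zero, zero_add]
    by_cases hs1 : B.card = 1
    · exfalso
      obtain ⟨x, rfl⟩ := Finset.card_eq_one.1 hs1
      simp only [Finset.sum_singleton, Finset.card_singleton] at hgood
      have ht : t x = 2 := by have := hit x; omega
      let L : ℕ → Prop := fun c => P c ∧ 2 * (colorClass G C c ∩ A).card < D + 1
      have h1 : (colorsAt G C x).filter L = colorsAt G C x :=
        Finset.eq_of_subset_of_card_le (Finset.filter_subset _ _) ((hC x).trans ht.ge)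
      have hcard : (colorsAt G C x).card = 2 := h1 ▸ ht
      have h2 : ∀ c ∈ colorsAt G C x, L c := Finset.filter_eq_self.1 h1
      have h3 := degree_add_card_colorsAt_le (C := C) (Finset.mem_insert_self x A) fun w hw => by
        rcases hB x (by simp) w hw with h | h
        · exact Finset.mem_insert_of_mem h
        · exact absurd (Finset.mem_singleton.1 h) hw.ne'
      have h4 : ∀ c ∈ colorsAt G C x,
          2 * (colorClass G C c ∩ insert x A).card ≤ D + 2 := by
        intro c hc
        have h5 : (colorClass G C c ∩ insert x A).card ≤ (colorClass G C c ∩ A).card + 1 := by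
          refine (Finset.card_le_card (t := insert x (colorClass G C c ∩ A)) ?_).trans
            (Finset.card_insert_le _ _)
          rw [Finset.insert_inter_distrib]
          exact Finset.inter_subset_inter_right (Finset.subset_insert _ _)
        have := (h2 c hc).2
        omega
      have h6 := Finset.sum_le_card_nsmul _ _ _ h4
      rw [← Finset.mul_sum, hcard, smul_eq_mul] at h6
      have := hdeg x
      omega
    · have : 2 * (B.card / 2) ≤ D * (B.card / 2) := Nat.mul_le_mul_right _ hD
      omega
  · have hDq : (2 : ℚ) ≤ D := by exact_mod_cast hD
    have hIsum : (D : ℚ) * I.card =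
        ∑ x ∈ B, ∑ c ∈ colorsAt G C x with ¬P c, (D : ℚ) / (colorClass G C c ∩ B).card := by
      have h1 : ∀ c ∈ I, (D : ℚ) =
          ∑ x ∈ colorClass G C c ∩ B, (D : ℚ) / (colorClass G C c ∩ B).card := by
        intro c hc
        obtain ⟨hc, hP⟩ := Finset.mem_filter.1 hc
        obtain ⟨x, hx, hcx⟩ := Finset.mem_biUnion.1 hc
        have h2 := htwo x hx c hcx hP
        rw [Finset.sum_const, nsmul_eq_mul, mul_div_cancel₀]
        exact_mod_cast (by omega : (colorClass G C c ∩ B).card ≠ 0)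
      rw [mul_comm, ← nsmul_eq_mul, ← Finset.sum_const, Finset.sum_congr rfl h1]
      refine Finset.sum_comm' fun c x => ?_
      simp only [I, Finset.mem_filter, Finset.mem_biUnion, Finset.mem_inter, mem_colorClass]
      exact ⟨fun h => ⟨⟨h.2.1, h.1.2⟩, h.2.2⟩, fun h => ⟨⟨⟨x, h.2, h.1.1⟩, h.1.2⟩, h.1.1, h.2⟩⟩
    have hpt : ∀ x ∈ B, ∑ c ∈ colorsAt G C x with ¬P c, (D : ℚ) / (colorClass G C c ∩ B).card +
        t x ≤ D / 2 + 1 := by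
      intro x hx
      have hix := hit x
      by_cases hi : i x = 2
      · obtain ⟨hcard, hnP, hN⟩ := hall x hx hi
        have h3 := degree_add_card_colorsAt_le (C := C) hx hN
        have h4 := hdeg x
        have ht : t x = 0 := by omega
        rw [Finset.filter_true_of_mem hnP, ht]
        obtain ⟨c, c', hcc, hc⟩ := Finset.card_eq_two.1 hcard
        rw [hcard, hc, Finset.sum_pair hcc] at h3
        rw [hc, Finset.sum_pair hcc, Nat.cast_zero, add_zero]
        have ha := htwo x hx c (by simp [hc]) (hnP c (by simp [hc]))
        have hb := htwo x hx c' (by simp [hc]) (hnP c' (by simp [hc]))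
        refine div_add_div_le_half_add_one (by exact_mod_cast ha) (by exact_mod_cast hb)
          (by positivity) ?_
        exact_mod_cast (by omega : D + 3 ≤ _)
      · have h1 : ∑ c ∈ colorsAt G C x with ¬P c, (D : ℚ) / (colorClass G C c ∩ B).card ≤
            i x * ((D : ℚ) / 2) := by
          rw [← nsmul_eq_mul]
          refine Finset.sum_le_card_nsmul _ _ _ fun c hc => ?_
          obtain ⟨hc, hP⟩ := Finset.mem_filter.1 hc
          have := htwo x hx c hc hP
          gcongr
          exact_mod_cast this
        have h2 : (i x : ℚ) + t x ≤ 2 := by exact_mod_cast hix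
        obtain h0 | h0 : i x = 0 ∨ i x = 1 := by omega
        · rw [h0] at h1 h2
          push_cast at h1 h2
          linarith
        · rw [h0] at h1 h2
          push_cast at h1 h2
          linarith
    have hsum := Finset.sum_le_card_nsmul _ _ _ hpt
    rw [Finset.sum_add_distrib, ← hIsum, nsmul_eq_mul] at hsum
    have hhalf : (B.card : ℚ) ≤ 2 * (B.card / 2 : ℕ) + 1 := by
      exact_mod_cast (by omega : B.card ≤ 2 * (B.card / 2) + 1)
    have hsq : (D : ℚ) + 1 ≤ B.card := by exact_mod_cast hs
    have hfin : (D : ℚ) * I.card + ∑ x ∈ B, (t x : ℚ) ≤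
        D * (B.card / 2 : ℕ) + (B.card + 2 * (B.card / 2 : ℕ)) := by
      nlinarith
    exact_mod_cast hfin

open Classical in
theorem card_colors_mul_le {V : Type*} [Fintype V] {G : SimpleGraph V} {C : Sym2 V → ℕ} {D m : ℕ}
    (hD : 2 ≤ D) (hdeg : ∀ v, D + 1 ≤ (Finset.univ.filter (G.Adj v)).card)
    (hC : ∀ v, (colorsAt G C v).card ≤ 2)
    (hm : ∀ N : Finset (Sym2 V), IsMatchingSet G (N : Set (Sym2 V)) → N.card ≤ m) :
    D * (Finset.univ.biUnion (colorsAt G C)).card ≤ (D + 2) * m + Fintype.card V := by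
  obtain ⟨A, p, hp, hA⟩ := exists_barrier G m hm
  let B : V → Finset V := fun b => Finset.univ.filter fun v => v ∉ A ∧ p v = b
  let P : ℕ → Prop := fun c => ∃ a ∈ A, c ∈ colorsAt G C a
  let I : V → Finset ℕ := fun b => ((B b).biUnion (colorsAt G C)).filter fun c => ¬P c
  have hBsum : ∀ f : V → ℕ, ∑ b, ∑ x ∈ B b, f x = ∑ x ∈ Aᶜ, f x := by
    intro f
    rw [← Finset.sum_fiberwise (s := Aᶜ) (g := p)]
    refine Finset.sum_congr rfl fun b _ => Finset.sum_congr ?_ fun _ _ => rfl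
    ext x
    simp [B]
  have hBcard : ∑ b, (B b).card + A.card = Fintype.card V := by
    have h := hBsum fun _ => 1
    simp only [← Finset.card_eq_sum_ones] at h
    rw [h, Finset.card_compl_add_card]
  have hcover : Finset.univ.biUnion (colorsAt G C) ⊆
      A.biUnion (colorsAt G C) ∪ Finset.univ.biUnion I := by
    intro c hc
    obtain ⟨v, -, hv⟩ := Finset.mem_biUnion.1 hc
    by_cases hP : P c
    · exact Finset.mem_union_left _ (Finset.mem_biUnion.2 hP)
    · refine Finset.mem_union_right _ (Finset.mem_biUnion.2 ⟨p v, Finset.mem_univ _, ?_⟩)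
      refine Finset.mem_filter.2 ⟨Finset.mem_biUnion.2 ⟨v, ?_, hv⟩, hP⟩
      simp only [B, Finset.mem_filter, Finset.mem_univ, true_and, and_true]
      exact fun hvA => hP ⟨v, hvA, hv⟩
  have hcount : (Finset.univ.biUnion (colorsAt G C)).card ≤
      (A.biUnion (colorsAt G C)).card + ∑ b, (I b).card :=
    (Finset.card_le_card hcover).trans <| (Finset.card_union_le _ _).trans <|
      Nat.add_le_add_left Finset.card_biUnion_le _
  have hT := card_touching_mul_le hD A hdeg hC
  have hI : ∀ b ∈ Finset.univ, D * (I b).card + ∑ x ∈ B b, lightCount G C D A x ≤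
      (D + 2) * ((B b).card / 2) + (B b).card := by
    intro b _
    refine (card_inside_mul_le hD (A := A) (B := B b) ?_ ?_ hdeg hC).trans (by linarith)
    · rw [Finset.disjoint_left]
      intro a ha haB
      exact (Finset.mem_filter.1 haB).2.1 ha
    · intro x hx w hxw
      obtain ⟨-, hxA, hxb⟩ := Finset.mem_filter.1 hx
      by_cases hw : w ∈ A
      · exact Or.inl hw
      · exact Or.inr (Finset.mem_filter.2
          ⟨Finset.mem_univ _, hw, (hp x w hxA hw hxw).symm.trans hxb⟩)
  have hIs := Finset.sum_le_sum hI
  rw [Finset.sum_add_distrib, Finset.sum_add_distrib, hBsum, ← Finset.mul_sum,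
    ← Finset.mul_sum] at hIs
  have h1 := Nat.mul_le_mul_left D hcount
  have h2 : (D + 2) * (A.card + ∑ b, (B b).card / 2) ≤ (D + 2) * m := Nat.mul_le_mul_left _ hA
  nlinarith

theorem colorsAt_coe {V : Type*} [Fintype V] (G : SimpleGraph V) (C : Sym2 V → ℕ) (v : V) :
    (colorsAt G C v : Set ℕ) = C '' G.incidenceSet v := by
  ext c
  simp only [Finset.mem_coe, mem_colorsAt, Set.mem_image]
  constructor
  · rintro ⟨w, hw, rfl⟩
    exact ⟨_, (G.mem_incidenceSet v w).2 hw, rfl⟩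
  · rintro ⟨e, he, rfl⟩
    obtain ⟨w, rfl⟩ := Sym2.mem_iff_exists.1 he.2
    exact ⟨w, he.1, rfl⟩

theorem biUnion_colorsAt_coe {V : Type*} [Fintype V] (G : SimpleGraph V) (C : Sym2 V → ℕ) :
    (Finset.univ.biUnion (colorsAt G C) : Set ℕ) = C '' G.edgeSet := by
  ext c
  simp only [Finset.mem_coe, Finset.mem_biUnion, Finset.mem_univ, true_and, mem_colorsAt,
    Set.mem_image]
  constructor
  · rintro ⟨v, w, hw, rfl⟩
    exact ⟨_, hw, rfl⟩
  · rintro ⟨e, he, rfl⟩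
    induction e with
    | _ v w => exact ⟨v, w, he, rfl⟩

theorem mul_OPT_le {V : Type*} [Fintype V] {G : SimpleGraph V} {D m : ℕ} (hD : 2 ≤ D)
    (hdeg : ∀ v, D + 1 ≤ (G.neighborSet v).ncard)
    (hm : ∀ N : Set (Sym2 V), IsMatchingSet G N → N.ncard ≤ m) :
    D * OPT G ≤ (D + 2) * m + Fintype.card V := by
  classical
  rw [mul_comm, ← Nat.le_div_iff_mul_le (by omega)]
  refine csSup_le' ?_
  rintro _ ⟨C, hC, rfl⟩
  rw [Nat.le_div_iff_mul_le (by omega), mul_comm, numColors, ← biUnion_colorsAt_coe,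
    Set.ncard_coe_finset]
  refine card_colors_mul_le hD (fun v => ?_) (fun v => ?_) fun N hN => ?_
  · refine (hdeg v).trans (le_of_eq ?_)
    rw [← Set.ncard_coe_finset]
    congr 1
    ext w
    simp
  · rw [← Set.ncard_coe_finset, colorsAt_coe]
    exact hC v
  · rw [← Set.ncard_coe_finset]
    exact hm _ hN

/-- Main theorem: for a connected graph with minimum degree `δ ≥ 3` and maximum matching
`M`, `OPT(G) ≤ (1 + ε)·ALG(G, M)` where `ε = (κ + 2)/(δ − 1)` and `κ = n/|M|`. -/
theorem opt_le_alg_general {V : Type*} [Fintype V] (G : SimpleGraph V)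
    (hconn : G.Connected) (δ : ℕ)
    (hδ3 : 3 ≤ δ) (hδ : ∀ v : V, δ ≤ (G.neighborSet v).ncard)
    (M : Set (Sym2 V)) (hM : IsMatchingSet G M)
    (hmax : ∀ M' : Set (Sym2 V), IsMatchingSet G M' → M'.ncard ≤ M.ncard) :
    (OPT G : ℝ) ≤
      (1 + ((Fintype.card V : ℝ) / (M.ncard : ℝ) + 2) / ((δ : ℝ) - 1)) * (ALG G M : ℝ) := by
  obtain ⟨v⟩ := hconn.nonempty
  have hmpos : 0 < M.ncard := by
    have hv : (G.neighborSet v).Nonempty :=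
      Set.nonempty_of_ncard_ne_zero (by have := hδ v; omega)
    obtain ⟨w, hw⟩ := hv
    have h := hmax {s(v, w)} ⟨by simpa using hw, by
      rintro e rfl f rfl hef
      exact absurd rfl hef⟩
    rw [Set.ncard_singleton] at h
    omega
  obtain ⟨D, rfl⟩ : ∃ D, δ = D + 1 := ⟨δ - 1, by omega⟩
  have hmain := mul_OPT_le (D := D) (by omega) hδ hmax
  have hmain' : (D : ℝ) * OPT G ≤ (D + 2) * M.ncard + Fintype.card V := by exact_mod_cast hmain
  have hDpos : (0 : ℝ) < D := by exact_mod_cast (by omega : 0 < D)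
  have hm0 : (0 : ℝ) < M.ncard := by exact_mod_cast hmpos
  have hALG : (M.ncard : ℝ) ≤ ALG G M := by exact_mod_cast Nat.le_add_right _ _
  have hD1 : ((D + 1 : ℕ) : ℝ) - 1 = D := by push_cast; ring
  rw [hD1]
  calc (OPT G : ℝ) ≤ ((D + 2) * M.ncard + Fintype.card V) / D := by
        rw [le_div_iff₀ hDpos, mul_comm]
        exact hmain'
    _ = (1 + ((Fintype.card V : ℝ) / M.ncard + 2) / D) * M.ncard := by
        field_simp
        ring
    _ ≤ _ := by gcongr
end

section
/- Let G be a finite simple connected d-regular graph with d ≥ 3 (every vertex has degree exactly d), and let M be a maximum matching of G. Then OPT(G) ≤ (1 + 6/(d − 1))·ALG(G, M). -/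
open SimpleGraph

theorem card_le_of_disjoint_closed_family {V ι : Type*} [Fintype V] [Fintype ι] [DecidableEq V]
    (G : SimpleGraph V) [DecidableRel G.Adj] {d : ℕ} (hd : 0 < d) (hreg : G.IsRegularOfDegree d)
    (S : Finset V) (K : ι → Finset V) (hdisj : Pairwise fun i j => Disjoint (K i) (K j))
    (hne : ∀ i, (K i).Nonempty)
    (hclosed : ∀ i, ∀ v ∈ K i, ∀ w, G.Adj v w → w ∈ S ∨ w ∈ K i) :
    Fintype.card ι ≤ S.card + Fintype.card V / (d + 1) := by
  classical
  have hbig : (Finset.univ.filter fun i => ¬ (K i).card ≤ d).card ≤ Fintype.card V / (d + 1) := by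
    rw [Nat.le_div_iff_mul_le (Nat.succ_pos d), ← smul_eq_mul]
    refine (Finset.card_nsmul_le_sum _ (fun i => (K i).card) (d + 1) fun i hi => ?_).trans ?_
    · simpa using hi
    · rw [← Finset.card_biUnion fun i _ j _ hij => hdisj hij]
      exact Finset.card_le_univ _
  have hsmall : (Finset.univ.filter fun i => (K i).card ≤ d).card ≤ S.card := by
    refine Nat.le_of_mul_le_mul_right ?_ hd
    have hedges : ∀ i ∈ Finset.univ.filter (fun i => (K i).card ≤ d),
        d ≤ ∑ v ∈ K i, (G.neighborFinset v ∩ S).card := by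
      intro i hi
      have hle : (K i).card ≤ d := by simpa using hi
      have hpos : 0 < (K i).card := (hne i).card_pos
      have hv : ∀ v ∈ K i, d + 1 - (K i).card ≤ (G.neighborFinset v ∩ S).card := by
        intro v hv
        have hsub : G.neighborFinset v ⊆ (G.neighborFinset v ∩ S) ∪ (K i).erase v := by
          intro w hw
          have hw' : G.Adj v w := by simpa using hw
          rcases hclosed i v hv w hw' with h | h
          · exact Finset.mem_union_left _ (Finset.mem_inter.2 ⟨hw, h⟩)
          · exact Finset.mem_union_right _ (Finset.mem_erase.2 ⟨hw'.ne', h⟩)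
        have h1 := (Finset.card_le_card hsub).trans (Finset.card_union_le _ _)
        rw [G.card_neighborFinset_eq_degree, hreg v, Finset.card_erase_of_mem hv] at h1
        omega
      have h2 := Finset.card_nsmul_le_sum (K i) _ _ hv
      refine le_trans ?_ h2
      obtain ⟨a, ha⟩ := Nat.exists_eq_add_of_le hle
      obtain ⟨b, hb⟩ := Nat.exists_eq_add_of_le' hpos
      have : d + 1 - (K i).card = a + 1 := by omega
      rw [this, smul_eq_mul, hb]
      have : d = a + b + 1 := by omega
      rw [this]
      nlinarith [Nat.zero_le (a * b)]
    have h3 := Finset.card_nsmul_le_sum _ _ _ hedges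
    rw [smul_eq_mul] at h3
    refine h3.trans ?_
    rw [← Finset.sum_biUnion fun i _ j _ hij => hdisj hij]
    refine (Finset.sum_le_sum_of_subset (Finset.subset_univ _)).trans ?_
    have h4 : ∀ v, (G.neighborFinset v ∩ S).card = (Finset.bipartiteAbove G.Adj S v).card := by
      intro v
      congr 1
      ext w
      simp [Finset.bipartiteAbove, and_comm]
    simp_rw [h4]
    rw [Finset.sum_card_bipartiteAbove_eq_sum_card_bipartiteBelow]
    rw [← smul_eq_mul]
    refine Finset.sum_le_card_nsmul _ _ _ fun w _ => ?_
    rw [← hreg w, ← G.card_neighborFinset_eq_degree]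
    refine Finset.card_le_card fun v hv => ?_
    simpa [Finset.bipartiteBelow, G.adj_comm] using hv
  have := Finset.card_filter_add_card_filter_not (s := (Finset.univ : Finset ι))
    (fun i => (K i).card ≤ d)
  rw [Finset.card_univ] at this
  omega

/-- The join of `G` with a complete graph on `W`. -/
def joinComplete {V : Type*} (G : SimpleGraph V) (W : Type*) : SimpleGraph (V ⊕ W) :=
  (Gᶜ ⊕g (⊥ : SimpleGraph W))ᶜ

theorem joinComplete_adj_inl {V W : Type*} {G : SimpleGraph V} {v w : V} :
    (joinComplete G W).Adj (.inl v) (.inl w) ↔ G.Adj v w := by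
  by_cases h : v = w
  · subst h; simp
  · simp [joinComplete, h]

theorem joinComplete_adj_inr {V W : Type*} {G : SimpleGraph V} {x : V ⊕ W} {w : W}
    (h : x ≠ .inr w) : (joinComplete G W).Adj x (.inr w) := by
  cases x <;> simp_all [joinComplete]

theorem exists_isPerfectMatching_joinComplete {V W : Type*} [Fintype V] [Fintype W]
    (G : SimpleGraph V) {d : ℕ} (hd : 0 < d) (hreg : ∀ v, (G.neighborSet v).ncard = d)
    (hW : Fintype.card V / (d + 1) ≤ Fintype.card W)
    (heven : Even (Fintype.card V + Fintype.card W)) :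
    ∃ N : (joinComplete G W).Subgraph, N.IsPerfectMatching := by
  classical
  rw [tutte]
  intro u hu
  rw [IsTutteViolator] at hu
  by_cases hT : ∀ w : W, Sum.inr w ∈ u
  · set H := ((⊤ : (joinComplete G W).Subgraph).deleteVerts u).coe with hH
    have hle : H.oddComponents.ncard ≤ Fintype.card H.ConnectedComponent := by
      rw [← Nat.card_eq_fintype_card, ← Set.ncard_univ]
      exact Set.ncard_le_ncard (Set.subset_univ _)
    have hreg' : G.IsRegularOfDegree d := by
      intro v
      rw [← hreg v, Set.ncard_eq_toFinset_card', ← G.card_neighborFinset_eq_degree]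
      rfl
    let S : Finset V := Finset.univ.filter fun v => Sum.inl v ∈ u
    have hcount := card_le_of_disjoint_closed_family (ι := H.ConnectedComponent) G hd hreg' S
      (fun c => Finset.univ.filter fun v =>
        ∃ h : Sum.inl v ∈ ((⊤ : (joinComplete G W).Subgraph).deleteVerts u).verts,
          H.connectedComponentMk ⟨Sum.inl v, h⟩ = c) ?_ ?_ ?_
    · have hu' : u.ncard = S.card + Fintype.card W := by
        have : u = ((S.disjSum Finset.univ : Finset (V ⊕ W)) : Set (V ⊕ W)) := by
          ext x
          cases x <;> simp [S, hT]
        rw [this, Set.ncard_coe_finset, Finset.card_disjSum, Finset.card_univ]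
      omega
    · intro c c' hcc
      rw [Finset.disjoint_left]
      intro v hv hv'
      simp only [Finset.mem_filter, Finset.mem_univ, true_and] at hv hv'
      obtain ⟨h, rfl⟩ := hv
      obtain ⟨_, rfl⟩ := hv'
      exact hcc rfl
    · intro c
      induction c using ConnectedComponent.ind with
      | h x =>
        obtain ⟨x, hx⟩ := x
        cases x with
        | inl v => exact ⟨v, Finset.mem_filter.2 ⟨Finset.mem_univ _, hx, rfl⟩⟩
        | inr w => exact absurd (hT w) (by simpa using hx)
    · intro c v hv w hvw
      simp only [Finset.mem_filter, Finset.mem_univ, true_and, S] at hv ⊢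
      obtain ⟨h, rfl⟩ := hv
      by_cases hw : Sum.inl w ∈ u
      · exact .inl hw
      · refine .inr ⟨by simpa using hw, ?_⟩
        rw [ConnectedComponent.eq]
        apply Adj.reachable
        have hv : Sum.inl v ∉ u := by simpa using h
        simp [hH, hv, hw, joinComplete_adj_inl, hvw.symm]
  · push Not at hT
    obtain ⟨w, hw⟩ := hT
    set H := ((⊤ : (joinComplete G W).Subgraph).deleteVerts u).coe with hH
    have hle : H.oddComponents.ncard ≤ 1 := by
      rw [Set.ncard_le_one]
      have key : ∀ c : H.ConnectedComponent,
          c = H.connectedComponentMk ⟨Sum.inr w, by simpa using hw⟩ := by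
        intro c
        induction c using ConnectedComponent.ind with
        | h x =>
          obtain ⟨x, hx⟩ := x
          by_cases hxw : x = Sum.inr w
          · subst hxw; rfl
          · rw [ConnectedComponent.eq]
            apply Adj.reachable
            have hx' : x ∉ u := by simpa using hx
            simp [hH, hw, hx', joinComplete_adj_inr hxw]
      intro a _ b _
      rw [key a, key b]
    have hu0 : u = ∅ := by
      rw [← Set.ncard_eq_zero]
      omega
    have hodd : Odd H.oddComponents.ncard := by
      have : H.oddComponents.ncard = 1 := by omega
      rw [this]; exact odd_one
    rw [odd_ncard_oddComponents] at hodd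
    subst hu0
    simp [Nat.card_eq_fintype_card] at hodd
    rw [← Nat.not_even_iff_odd] at hodd
    exact hodd heven

theorem exists_isMatchingSet_of_isPerfectMatching_joinComplete {V W : Type*} [Fintype V]
    [Fintype W] {G : SimpleGraph V} {N : (joinComplete G W).Subgraph} (hN : N.IsPerfectMatching) :
    ∃ M, IsMatchingSet G M ∧ Fintype.card V ≤ 2 * M.ncard + Fintype.card W := by
  classical
  rw [Subgraph.isPerfectMatching_iff] at hN
  let L := N.spanningCoe.comap (Sum.inl : V → V ⊕ W)
  have hL : ∀ v w, L.Adj v w ↔ N.Adj (.inl v) (.inl w) := fun v w => by simp [L]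
  refine ⟨L.edgeSet, ⟨?_, ?_⟩, ?_⟩
  · rw [edgeSet_subset_edgeSet]
    intro v w h
    exact joinComplete_adj_inl.1 ((hL v w).1 h).adj_sub
  · intro e he f hf hef v hve hvf
    obtain ⟨a, rfl⟩ := hve
    obtain ⟨b, rfl⟩ := hvf
    rw [mem_edgeSet, hL] at he hf
    have := Sum.inl_injective ((hN _).unique he hf)
    exact hef (by rw [this])
  · have hdeg : ∑ v, L.degree v = 2 * L.edgeFinset.card := L.sum_degrees_eq_twice_card_edges
    have hM : L.edgeSet.ncard = L.edgeFinset.card := by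
      rw [← coe_edgeFinset, Set.ncard_coe_finset]
    rw [hM, ← hdeg]
    have hzero : (Finset.univ.filter fun v : V => L.degree v = 0).card ≤ Fintype.card W := by
      have hex : ∀ v, L.degree v = 0 → ∃ w : W, N.Adj (.inl v) (.inr w) := by
        intro v hv
        obtain ⟨x, hx, _⟩ := hN (.inl v)
        cases x with
        | inl a =>
          have : 0 < L.degree v := (L.degree_pos_iff_exists_adj v).2 ⟨a, (hL v a).2 hx⟩
          omega
        | inr w => exact ⟨w, hx⟩
      rw [← Finset.card_univ]
      refine Finset.card_le_card_of_forall_subsingleton (fun v w => N.Adj (.inl v) (.inr w))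
        (fun v hv => ?_) fun w _ a ha b hb => ?_
      · obtain ⟨w, hw⟩ := hex v (by simpa using hv)
        exact ⟨w, Finset.mem_univ _, hw⟩
      · exact Sum.inl_injective ((hN _).unique ha.2.symm hb.2.symm)
    have hpos : (Finset.univ.filter fun v : V => ¬ L.degree v = 0).card ≤ ∑ v, L.degree v := by
      rw [Finset.card_filter]
      exact Finset.sum_le_sum fun v _ => by split_ifs <;> omega
    have := Finset.card_filter_add_card_filter_not (s := (Finset.univ : Finset V))
      (fun v => L.degree v = 0)
    rw [Finset.card_univ] at this
    omega

theorem exists_large_isMatchingSet {V : Type*} [Fintype V] (G : SimpleGraph V) {d : ℕ}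
    (hd : 0 < d) (hreg : ∀ v, (G.neighborSet v).ncard = d) :
    ∃ M, IsMatchingSet G M ∧ Fintype.card V ≤ 2 * M.ncard + (Fintype.card V / (d + 1) + 1) := by
  obtain ⟨t, ht, ht', heven⟩ : ∃ t, Fintype.card V / (d + 1) ≤ t ∧
      t ≤ Fintype.card V / (d + 1) + 1 ∧ Even (Fintype.card V + t) := by
    rcases Nat.even_or_odd (Fintype.card V + Fintype.card V / (d + 1)) with h | h
    · exact ⟨_, le_rfl, by omega, h⟩
    · exact ⟨_, Nat.le_succ _, le_rfl, h.add_one⟩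
  obtain ⟨N, hN⟩ := exists_isPerfectMatching_joinComplete (W := Fin t) G hd hreg
    (by simpa using ht) (by simpa using heven)
  obtain ⟨M, hM, hcard⟩ := exists_isMatchingSet_of_isPerfectMatching_joinComplete hN
  rw [Fintype.card_fin] at hcard
  exact ⟨M, hM, by omega⟩

theorem inv_add_inv_le_of_add_eq {a b d : ℕ} (ha : 1 ≤ a) (hb : 1 ≤ b) (h : a + b = d) :
    ((a : ℚ) + 1)⁻¹ + ((b : ℚ) + 1)⁻¹ ≤ 1 / 2 + 1 / d := by
  have ha' : (1 : ℚ) ≤ a := by exact_mod_cast ha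
  have hb' : (1 : ℚ) ≤ b := by exact_mod_cast hb
  subst h
  push_cast
  rw [inv_eq_one_div, inv_eq_one_div, div_add_div _ _ (by positivity) (by positivity),
    div_add_div _ _ (by positivity) (by positivity), div_le_div_iff₀ (by positivity) (by positivity)]
  nlinarith [mul_nonneg (sub_nonneg.2 ha') (sub_nonneg.2 hb'),
    mul_nonneg (mul_nonneg (sub_nonneg.2 ha') (sub_nonneg.2 hb')) (by linarith : (0 : ℚ) ≤ a + b)]

theorem two_mul_numColors_le {V : Type*} [Fintype V] (G : SimpleGraph V) {d : ℕ} (hd : 2 ≤ d)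
    (hreg : ∀ v, (G.neighborSet v).ncard = d) {C : Sym2 V → ℕ} (hC : IsEdge2Coloring G C) :
    2 * d * numColors G C ≤ Fintype.card V * (d + 2) := by
  classical
  have hdeg : ∀ v, (G.neighborFinset v).card = d := by
    intro v
    rw [← hreg v, Set.ncard_eq_toFinset_card']
    rfl
  let palette : V → Finset ℕ := fun v => (G.neighborFinset v).image fun w => C s(v, w)
  let colored : ℕ → Finset V := fun c => Finset.univ.filter fun v => c ∈ palette v
  have hpal : ∀ v, (palette v).card ≤ 2 := by
    intro v
    refine le_trans (le_of_eq ?_) (hC v)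
    rw [← Set.ncard_coe_finset]
    congr 1
    ext c
    simp only [palette, Finset.coe_image, Set.mem_image, Finset.mem_coe, mem_neighborFinset]
    constructor
    · rintro ⟨w, hw, rfl⟩
      exact ⟨s(v, w), ⟨hw, by simp⟩, rfl⟩
    · rintro ⟨e, ⟨he, w, rfl⟩, rfl⟩
      exact ⟨w, he, rfl⟩
  have hnum : numColors G C = (Finset.univ.biUnion palette).card := by
    rw [numColors, ← Set.ncard_coe_finset]
    congr 1
    ext c
    simp only [palette, Finset.coe_biUnion, Finset.coe_image, Set.mem_image, Finset.mem_coe,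
      mem_neighborFinset, Set.mem_iUnion, Finset.mem_univ, exists_prop, true_and]
    constructor
    · rintro ⟨e, he, rfl⟩
      induction e with
      | h v w => exact ⟨v, w, he, rfl⟩
    · rintro ⟨v, w, h, rfl⟩
      exact ⟨s(v, w), h, rfl⟩
  have hcolored : ∀ v, ∀ c ∈ palette v,
      ((G.neighborFinset v).filter fun w => C s(v, w) = c).card + 1 ≤ (colored c).card := by
    intro v c hc
    rw [← Finset.card_insert_of_notMem (a := v) (by simp)]
    refine Finset.card_le_card fun w hw => ?_
    rw [Finset.mem_insert] at hw
    simp only [colored, Finset.mem_filter, Finset.mem_univ, true_and]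
    rcases hw with rfl | hw
    · exact hc
    · simp only [Finset.mem_filter, mem_neighborFinset] at hw
      exact Finset.mem_image.2 ⟨v, by simpa using hw.1.symm, by rw [Sym2.eq_swap]; exact hw.2⟩
  have hlocal : ∀ v, ∑ c ∈ palette v, ((colored c).card : ℚ)⁻¹ ≤ 1 / 2 + 1 / d := by
    intro v
    let m : ℕ → ℕ := fun c => ((G.neighborFinset v).filter fun w => C s(v, w) = c).card
    have hm : ∀ c ∈ palette v, 1 ≤ m c := by
      intro c hc
      obtain ⟨w, hw, rfl⟩ := Finset.mem_image.1 hc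
      exact Finset.card_pos.2 ⟨w, Finset.mem_filter.2 ⟨hw, rfl⟩⟩
    have hsum : ∑ c ∈ palette v, m c = d := by
      rw [← hdeg v]
      exact (Finset.card_eq_sum_card_image _ _).symm
    have hle : ∑ c ∈ palette v, ((colored c).card : ℚ)⁻¹ ≤
        ∑ c ∈ palette v, ((m c : ℚ) + 1)⁻¹ := by
      refine Finset.sum_le_sum fun c hc => inv_anti₀ (by positivity) ?_
      exact_mod_cast hcolored v c hc
    refine hle.trans ?_
    have h2 := hpal v
    have hd' : (0 : ℚ) < d := by exact_mod_cast (by omega : 0 < d)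
    interval_cases h : (palette v).card
    · rw [Finset.card_eq_zero] at h
      rw [h, Finset.sum_empty]
      positivity
    · obtain ⟨c, hc⟩ := Finset.card_eq_one.1 h
      rw [hc, Finset.sum_singleton] at hsum ⊢
      rw [hsum, ← one_div]
      have := one_div_le_one_div_of_le hd' (by linarith : (d : ℚ) ≤ d + 1)
      linarith
    · obtain ⟨a, b, hab, hc⟩ := Finset.card_eq_two.1 h
      rw [hc, Finset.sum_pair hab] at hsum ⊢
      exact inv_add_inv_le_of_add_eq (hm a (by simp [hc])) (hm b (by simp [hc])) hsum
  have hdouble : (numColors G C : ℚ) = ∑ v, ∑ c ∈ palette v, ((colored c).card : ℚ)⁻¹ := by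
    rw [Finset.sum_comm' (t' := Finset.univ.biUnion palette) (s' := colored)
      (by simp only [colored, Finset.mem_biUnion, Finset.mem_filter, Finset.mem_univ, true_and]
          exact fun v c => ⟨fun h => ⟨h, v, h⟩, fun h => h.1⟩)]
    rw [hnum, Finset.card_eq_sum_ones, Nat.cast_sum]
    refine Finset.sum_congr rfl fun c hc => ?_
    obtain ⟨v, _, hv⟩ := Finset.mem_biUnion.1 hc
    have : 0 < (colored c).card := Finset.card_pos.2 ⟨v, by simpa [colored] using hv⟩
    rw [Finset.sum_const, nsmul_eq_mul, mul_inv_cancel₀ (by positivity)]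
    simp
  have hfinal : (numColors G C : ℚ) ≤ Fintype.card V * (1 / 2 + 1 / d) := by
    rw [hdouble]
    refine (Finset.sum_le_sum fun v _ => hlocal v).trans ?_
    rw [Finset.sum_const, Finset.card_univ, nsmul_eq_mul]
  have hd' : (0 : ℚ) < d := by exact_mod_cast (by omega : 0 < d)
  have h3 := mul_le_mul_of_nonneg_left hfinal (by positivity : (0 : ℚ) ≤ 2 * d)
  have h4 : 2 * (d : ℚ) * (Fintype.card V * (1 / 2 + 1 / d)) = Fintype.card V * (d + 2) := by
    field_simp
  rw [h4] at h3
  exact_mod_cast h3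

theorem two_mul_OPT_le {V : Type*} [Fintype V] (G : SimpleGraph V) {d : ℕ} (hd : 2 ≤ d)
    (hreg : ∀ v, (G.neighborSet v).ncard = d) :
    2 * d * OPT G ≤ Fintype.card V * (d + 2) := by
  have hpos : 0 < 2 * d := by omega
  rw [mul_comm, ← Nat.le_div_iff_mul_le hpos]
  refine csSup_le ⟨_, fun _ => 0, fun v => ?_, rfl⟩ ?_
  · refine (Set.ncard_le_ncard (t := {0}) ?_).trans (by simp)
    rintro _ ⟨_, _, rfl⟩
    rfl
  · rintro _ ⟨C, hC, rfl⟩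
    rw [Nat.le_div_iff_mul_le hpos, mul_comm]
    exact two_mul_numColors_le G hd hreg hC

/-- For a connected `d`-regular graph with `d ≥ 3` and a maximum matching `M`,
`OPT(G) ≤ (1 + 6/(d − 1))·ALG(G, M)`. -/
theorem opt_le_alg_regular {V : Type*} [Fintype V] (G : SimpleGraph V)
    (hconn : G.Connected) (d : ℕ) (hd : 3 ≤ d)
    (hreg : ∀ v : V, (G.neighborSet v).ncard = d)
    (M : Set (Sym2 V)) (hM : IsMatchingSet G M)
    (hmax : ∀ M' : Set (Sym2 V), IsMatchingSet G M' → M'.ncard ≤ M.ncard) :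
    (OPT G : ℝ) ≤ (1 + 6 / ((d : ℝ) - 1)) * (ALG G M : ℝ) := by
  have hV : Nonempty V := hconn.nonempty
  have hn : d + 1 ≤ Fintype.card V := by
    classical
    have v : V := hV.some
    have := G.degree_lt_card_verts v
    have hdeg : G.degree v = d := by
      rw [← hreg v, Set.ncard_eq_toFinset_card', ← G.card_neighborFinset_eq_degree]
      rfl
    omega
  have hopt := two_mul_OPT_le G (by omega : 2 ≤ d) hreg
  obtain ⟨M', hM', hcard⟩ := exists_large_isMatchingSet G (by omega : 0 < d) hreg
  have hle := hmax M' hM'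
  have hdiv := Nat.div_mul_le_self (Fintype.card V) (d + 1)
  have halg : M.ncard ≤ ALG G M := Nat.le_add_right _ _
  have hnat : Fintype.card V * (d + 1) ≤ 2 * ALG G M * (d + 1) + 2 * Fintype.card V := by
    have := Nat.mul_le_mul_right (d + 1)
      (show Fintype.card V ≤ 2 * ALG G M + (Fintype.card V / (d + 1) + 1) by omega)
    nlinarith
  generalize Fintype.card V = n at *
  generalize ALG G M = A at *
  generalize OPT G = k at *
  have hopt' : 2 * (d : ℝ) * k ≤ n * (d + 2) := by exact_mod_cast hopt
  have hnat' : (n : ℝ) * (d + 1) ≤ 2 * A * (d + 1) + 2 * n := by exact_mod_cast hnat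
  have hd' : (3 : ℝ) ≤ d := by exact_mod_cast hd
  have hn' : (0 : ℝ) ≤ n := Nat.cast_nonneg n
  have hd1 : (0 : ℝ) < d - 1 := by linarith
  have hratio : 1 + 6 / ((d : ℝ) - 1) = (d + 5) / (d - 1) := by
    field_simp
    ring
  rw [hratio, div_mul_eq_mul_div, le_div_iff₀ hd1]
  have hA : (n : ℝ) * (d - 1) ≤ 2 * A * (d + 1) := by linarith
  have h1 : 2 * (d : ℝ) * (d + 1) * (k * (d - 1)) ≤ n * (d + 2) * ((d + 1) * (d - 1)) := by
    nlinarith [mul_le_mul_of_nonneg_right hopt' (by nlinarith : (0 : ℝ) ≤ (d + 1) * (d - 1))]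
  have h2 : n * (d - 1) * (d * (d + 5)) ≤ 2 * (d : ℝ) * (d + 1) * ((d + 5) * A) := by
    nlinarith [mul_le_mul_of_nonneg_right hA (by nlinarith : (0 : ℝ) ≤ d * (d + 5))]
  have h3 : n * (d + 2) * (((d : ℝ) + 1) * (d - 1)) ≤ n * (d - 1) * (d * (d + 5)) := by
    have : 0 ≤ (n : ℝ) * (d - 1) := by positivity
    nlinarith [mul_nonneg this hd1.le]
  exact le_of_mul_le_mul_left (h1.trans (h3.trans h2)) (by positivity)
end

section
/- Let G be a finite simple graph, let C be an edge 2-coloring of G, and let χ be a characteristic subgraph of G with respect to C whose maximum degree is at most 2. Then every vertex of degree 0 in χ has at most 4 neighbors in G that have degree 2 in χ, and every vertex u of degree 1 in χ has at most 2 neighbors w in G such that w has degree 2 in χ and the edge uw is not an edge of χ. -/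
open SimpleGraph

/-- The vertices incident to an edge of `H` of color `c`. -/
def colorVerts {V : Type*} (H : SimpleGraph V) (C : Sym2 V → ℕ) (c : ℕ) : Set V :=
  {w | ∃ e ∈ H.edgeSet, w ∈ e ∧ C e = c}

/-- Two edges of a characteristic subgraph with the same color coincide. -/
theorem IsCharSubgraph.injOn {V : Type*} {G : SimpleGraph V} {C : Sym2 V → ℕ}
    {H : SimpleGraph V} (hH : IsCharSubgraph G C H) : Set.InjOn C H.edgeSet := by
  intro e he f hf hef
  have hG : H.edgeSet ⊆ G.edgeSet := SimpleGraph.edgeSet_mono hH.1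
  exact (hH.2 (C e) ⟨e, hG he, rfl⟩).unique ⟨he, rfl⟩ ⟨hf, hef.symm⟩

theorem IsCharSubgraph.ncard_colorVerts_le {V : Type*} {G : SimpleGraph V}
    {C : Sym2 V → ℕ} {H : SimpleGraph V} (hH : IsCharSubgraph G C H) (c : ℕ) :
    (colorVerts H C c).ncard ≤ 2 := by
  rcases (colorVerts H C c).eq_empty_or_nonempty with h | ⟨_, e, he, -, rfl⟩
  · simp [h]
  · induction e with
    | _ a b =>
      refine (Set.ncard_le_ncard (t := {a, b}) ?_ (Set.toFinite _)).trans
        ((Set.ncard_insert_le a {b}).trans (by simp))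
      rintro w ⟨f, hf, hwf, hfc⟩
      rw [hH.injOn hf he hfc] at hwf
      simpa using hwf

/-- At a vertex `w` of degree 2 in a characteristic subgraph, every edge of `G` has the color
of an edge of the characteristic subgraph at `w`. -/
theorem IsCharSubgraph.mem_colorVerts {V : Type*} [Finite V] {G : SimpleGraph V}
    {C : Sym2 V → ℕ} {H : SimpleGraph V} (hH : IsCharSubgraph G C H)
    (hC : IsEdge2Coloring G C) {u w : V} (huw : G.Adj u w)
    (hw : (H.neighborSet w).ncard = 2) : w ∈ colorVerts H C (C s(u, w)) := by
  have hcard : (C '' H.incidenceSet w).ncard = 2 := by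
    classical
    rw [(hH.injOn.mono (H.incidenceSet_subset w)).ncard_image, ← hw]
    exact Nat.card_congr (H.incidenceSetEquivNeighborSet w)
  have hsub : C '' H.incidenceSet w ⊆ C '' G.incidenceSet w :=
    Set.image_mono fun e he => ⟨SimpleGraph.edgeSet_mono hH.1 he.1, he.2⟩
  have heq := Set.eq_of_subset_of_ncard_le hsub (by rw [hcard]; exact hC w)
    ((Set.toFinite _).image C)
  have hmem : C s(u, w) ∈ C '' G.incidenceSet w := ⟨s(u, w), ⟨huw, by simp⟩, rfl⟩
  rw [← heq] at hmem
  obtain ⟨e, he, hec⟩ := hmem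
  exact ⟨e, he.1, he.2, hec⟩

/-- A set of vertices covered by the edges of `H` with colors in `T` has at most `2 * |T|`
elements. -/
theorem IsCharSubgraph.ncard_le_of_subset {V : Type*} [Finite V] {G : SimpleGraph V}
    {C : Sym2 V → ℕ} {H : SimpleGraph V} (hH : IsCharSubgraph G C H) {S : Set V} {T : Set ℕ}
    (hT : T.Finite) (hS : ∀ w ∈ S, ∃ c ∈ T, w ∈ colorVerts H C c) :
    S.ncard ≤ 2 * T.ncard := by
  have hsub : S ⊆ ⋃ c ∈ hT.toFinset, colorVerts H C c := by
    intro w hw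
    simpa using hS w hw
  calc S.ncard ≤ (⋃ c ∈ hT.toFinset, colorVerts H C c).ncard :=
        Set.ncard_le_ncard hsub (Set.toFinite _)
    _ ≤ ∑ c ∈ hT.toFinset, (colorVerts H C c).ncard := Finset.set_ncard_biUnion_le _ _
    _ ≤ ∑ _c ∈ hT.toFinset, 2 := Finset.sum_le_sum fun c _ => hH.ncard_colorVerts_le c
    _ = 2 * T.ncard := by
        rw [Finset.sum_const, smul_eq_mul, Set.ncard_eq_toFinset_card T hT, mul_comm]

/-- In a characteristic subgraph `H` of maximum degree at most 2: a vertex of degree 0 in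
`H` has at most 4 neighbors (in `G`) of degree 2 in `H`, and a vertex of degree 1 in `H`
has at most 2 neighbors of degree 2 in `H` through edges not in `H`. -/
theorem charSubgraph_degree_bounds {V : Type*} [Fintype V] (G : SimpleGraph V)
    (C : Sym2 V → ℕ) (hC : IsEdge2Coloring G C)
    (H : SimpleGraph V) (hH : IsCharSubgraph G C H)
    (hdeg : ∀ v : V, (H.neighborSet v).ncard ≤ 2) :
    (∀ u : V, (H.neighborSet u).ncard = 0 →
      ({w : V | G.Adj u w ∧ (H.neighborSet w).ncard = 2}).ncard ≤ 4) ∧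
    (∀ u : V, (H.neighborSet u).ncard = 1 →
      ({w : V | G.Adj u w ∧ (H.neighborSet w).ncard = 2 ∧ ¬ H.Adj u w}).ncard ≤ 2) := by
  have hfin (u : V) : (C '' G.incidenceSet u).Finite := (Set.toFinite _).image C
  refine ⟨fun u _ => ?_, fun u hu => ?_⟩
  · have h := hH.ncard_le_of_subset
      (S := {w : V | G.Adj u w ∧ (H.neighborSet w).ncard = 2}) (hfin u) fun w hw =>
        ⟨C s(u, w), ⟨s(u, w), ⟨hw.1, by simp⟩, rfl⟩, hH.mem_colorVerts hC hw.1 hw.2⟩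
    have := hC u
    omega
  · obtain ⟨x, hx⟩ := Set.ncard_eq_one.mp hu
    have hux : H.Adj u x := by
      rw [← SimpleGraph.mem_neighborSet, hx]
      rfl
    have h := hH.ncard_le_of_subset
      (S := {w : V | G.Adj u w ∧ (H.neighborSet w).ncard = 2 ∧ ¬ H.Adj u w})
      (T := (C '' G.incidenceSet u) \ {C s(u, x)}) (hfin u).sdiff fun w hw => by
        have hmem := hH.mem_colorVerts hC hw.1 hw.2.1
        refine ⟨C s(u, w), ⟨⟨s(u, w), ⟨hw.1, by simp⟩, rfl⟩, fun hc => ?_⟩, hmem⟩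
        obtain ⟨e, he, hwe, hec⟩ := hmem
        rw [hH.injOn he hux (hec.trans hc), Sym2.mem_iff] at hwe
        rcases hwe with rfl | rfl
        · exact hw.1.ne rfl
        · exact hw.2.2 hux
    have hcu : C s(u, x) ∈ C '' G.incidenceSet u := ⟨s(u, x), ⟨hH.1 hux, by simp⟩, rfl⟩
    have := Set.ncard_sdiff_singleton_add_one hcu (hfin u)
    have := hC u
    omega
end
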